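/- Let n ≥ 1 and 0 < α < 2. If u ∈ L_α is α-harmonic in the sense of distributions, then u agrees almost everywhere with a function ũ that is smooth (C^∞) on ℝⁿ and is α-harmonic in the average sense at every point: for each x ∈ ℝⁿ and each r > 0, (ε_α^{(r)} * ũ)(x) = ũ(x). Conversely, if u ∈ L_α is continuous and α-harmonic in the average sense at every point, then u is α-harmonic in the sense of distributions. -/

import Mathlib

open MeasureTheory Filter Topology Metric

noncomputable section

/-- Membership in the space `L_α`. -/
def InLalpha (n : ℕ) (α : ℝ) (u : EuclideanSpace ℝ (Fin n) → ℝ) : Prop :=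
  Integrable (fun x : EuclideanSpace ℝ (Fin n) => u x / (1 + ‖x‖ ^ ((n : ℝ) + α)))

/-- Principal-value fractional Laplacian (up to the normalizing constant). -/
def IsFracLapAt (n : ℕ) (α : ℝ) (φ : EuclideanSpace ℝ (Fin n) → ℝ)
    (x : EuclideanSpace ℝ (Fin n)) (L : ℝ) : Prop :=
  Tendsto (fun ε : ℝ =>
      ∫ z in {z : EuclideanSpace ℝ (Fin n) | ε < ‖x - z‖},
        (φ x - φ z) / ‖x - z‖ ^ ((n : ℝ) + α))
    (𝓝[>] 0) (𝓝 L)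

/-- `α`-harmonicity in the sense of distributions. -/
def AlphaHarmonic (n : ℕ) (α : ℝ) (u : EuclideanSpace ℝ (Fin n) → ℝ) : Prop :=
  ∀ φ : EuclideanSpace ℝ (Fin n) → ℝ, ContDiff ℝ (⊤ : ℕ∞) φ → HasCompactSupport φ →
    ∀ g : EuclideanSpace ℝ (Fin n) → ℝ,
      (∀ x, IsFracLapAt n α φ x (g x)) → ∫ x, u x * g x = 0

/-- The averaging kernel `ε_α^{(r)}`. -/
def avgKernel (n : ℕ) (α r : ℝ) (x : EuclideanSpace ℝ (Fin n)) : ℝ :=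
  if r < ‖x‖ then
    (Real.Gamma ((n : ℝ) / 2) / Real.pi ^ ((n : ℝ) / 2 + 1)) * Real.sin (Real.pi * α / 2) *
      (r ^ α / ((‖x‖ ^ 2 - r ^ 2) ^ (α / 2) * ‖x‖ ^ n))
  else 0

/-- The convolution `(ε_α^{(r)} * w)(x) = ∫_{|y-x|>r} ε_α^{(r)}(x-y) w(y) dy`. -/
def avgConv (n : ℕ) (α r : ℝ) (w : EuclideanSpace ℝ (Fin n) → ℝ)
    (x : EuclideanSpace ℝ (Fin n)) : ℝ :=
  ∫ y in {y : EuclideanSpace ℝ (Fin n) | r < ‖y - x‖}, avgKernel n α r (x - y) * w y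

/-- The symmetric second difference `2 φ(x) - φ(x + y) - φ(x - y)`. -/
def secondDiff {E F : Type*} [AddGroup E] [AddCommGroup F] (φ : E → F) (x y : E) : F :=
  φ x + φ x - φ (x + y) - φ (x - y)

/-- `φ` is continuous, and `φ` and its second differences decay of order `N`. -/
structure DecayBound {E F : Type*} [NormedAddCommGroup E] [NormedAddCommGroup F]
    (N A : ℝ) (φ : E → F) : Prop where
  cont : Continuous φ
  bound : ∀ x, ‖φ x‖ ≤ A * (1 + ‖x‖) ^ (-N)
  diff2 : ∀ x y, ‖y‖ ≤ 1 → ‖secondDiff φ x y‖ ≤ A * ‖y‖ ^ 2 * (1 + ‖x‖) ^ (-N)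

section Decay

variable {E F : Type*} [NormedAddCommGroup E] [NormedAddCommGroup F]

theorem one_add_norm_le_mul (x y : E) : 1 + ‖x‖ ≤ (1 + ‖y‖) * (1 + ‖x - y‖) := by
  have : ‖x‖ ≤ ‖x - y‖ + ‖y‖ := by simpa using norm_add_le (x - y) y
  nlinarith [norm_nonneg y, norm_nonneg (x - y), mul_nonneg (norm_nonneg y) (norm_nonneg (x - y))]

theorem one_add_norm_rpow_neg_le {N : ℝ} (hN : 0 ≤ N) (x y : E) :
    (1 + ‖y‖) ^ (-N) ≤ (1 + ‖x - y‖) ^ N * (1 + ‖x‖) ^ (-N) := by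
  have hx : 0 < 1 + ‖x‖ := by positivity
  have hy : 0 < 1 + ‖y‖ := by positivity
  have hxy : 0 < 1 + ‖x - y‖ := by positivity
  rw [Real.rpow_neg hy.le, Real.rpow_neg hx.le, ← div_eq_mul_inv, inv_eq_one_div,
    div_le_div_iff₀ (by positivity) (by positivity), one_mul,
    ← Real.mul_rpow hxy.le hy.le]
  exact Real.rpow_le_rpow hx.le ((one_add_norm_le_mul x y).trans_eq (mul_comm _ _)) hN

variable [NormedSpace ℝ E] [NormedSpace ℝ F]

theorem norm_taylor_one_le {φ : E → F} (hφ : ContDiff ℝ 2 φ) {B : ℝ} {x y : E}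
    (hB : ∀ z ∈ closedBall x ‖y‖, ‖iteratedFDeriv ℝ 2 φ z‖ ≤ B) :
    ‖φ (x + y) - φ x - fderiv ℝ φ x y‖ ≤ B * ‖y‖ ^ 2 := by
  have hd : Differentiable ℝ φ := hφ.differentiable (by norm_num)
  have hd1 : ContDiff ℝ 1 (fderiv ℝ φ) := hφ.fderiv_right (by norm_num)
  have hd' : Differentiable ℝ (fderiv ℝ φ) := hd1.differentiable (by norm_num)
  have hx : x ∈ closedBall x ‖y‖ := mem_closedBall_self (norm_nonneg _)
  have hB' : ∀ z ∈ closedBall x ‖y‖, ‖fderiv ℝ (fderiv ℝ φ) z‖ ≤ B := by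
    intro z hz
    refine le_trans (le_of_eq ?_) (hB z hz)
    rw [← norm_iteratedFDeriv_fderiv, ← norm_iteratedFDeriv_one]
  have hB0 : 0 ≤ B := (norm_nonneg _).trans (hB x hx)
  have h1 : ∀ z ∈ closedBall x ‖y‖, ‖fderiv ℝ φ z - fderiv ℝ φ x‖ ≤ B * ‖y‖ := by
    intro z hz
    refine ((convex_closedBall x ‖y‖).norm_image_sub_le_of_norm_fderiv_le
      (fun w _ => hd' w) hB' hx hz).trans ?_
    gcongr
    simpa [dist_eq_norm] using hz
  have h2 := (convex_closedBall x ‖y‖).norm_image_sub_le_of_norm_fderiv_le'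
      (fun w _ => hd w) h1 hx (y := x + y) (by simp)
  simpa [pow_two, mul_assoc] using h2

theorem norm_secondDiff_le {φ : E → F} (hφ : ContDiff ℝ 2 φ) {B : ℝ} {x y : E}
    (hB : ∀ z ∈ closedBall x ‖y‖, ‖iteratedFDeriv ℝ 2 φ z‖ ≤ B) :
    ‖secondDiff φ x y‖ ≤ 2 * B * ‖y‖ ^ 2 := by
  have h1 := norm_taylor_one_le hφ hB
  have h2 := norm_taylor_one_le (y := -y) hφ (by simpa using hB)
  have : secondDiff φ x y = -((φ (x + y) - φ x - fderiv ℝ φ x y) +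
      (φ (x + -y) - φ x - fderiv ℝ φ x (-y))) := by
    simp only [secondDiff, map_neg, ← sub_eq_add_neg]
    abel
  rw [this, norm_neg]
  rw [norm_neg] at h2
  linarith [norm_add_le (φ (x + y) - φ x - fderiv ℝ φ x y)
      (φ (x + -y) - φ x - fderiv ℝ φ x (-y))]

theorem DecayBound.of_contDiff {φ : E → F} (hφ : ContDiff ℝ 2 φ) {N A : ℝ} (hN : 0 ≤ N)
    (h0 : ∀ x, ‖φ x‖ ≤ A * (1 + ‖x‖) ^ (-N))
    (h2 : ∀ x, ‖iteratedFDeriv ℝ 2 φ x‖ ≤ A * (1 + ‖x‖) ^ (-N)) :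
    DecayBound N (2 * 2 ^ N * A) φ := by
  have hA : 0 ≤ A := by
    have h := (norm_nonneg _).trans (h0 0)
    simpa using h
  have h2N : (1 : ℝ) ≤ 2 ^ N := Real.one_le_rpow (by norm_num) hN
  refine ⟨hφ.continuous, fun x => (h0 x).trans ?_, fun x y hy => ?_⟩
  · gcongr
    nlinarith
  · refine (norm_secondDiff_le hφ (B := A * (2 ^ N * (1 + ‖x‖) ^ (-N))) ?_).trans_eq (by ring)
    intro z hz
    refine (h2 z).trans ?_
    gcongr
    refine (one_add_norm_rpow_neg_le hN x z).trans ?_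
    gcongr
    have : ‖x - z‖ ≤ ‖y‖ := by simpa [dist_eq_norm, norm_sub_rev] using hz
    linarith

end Decay

section Kernel

variable {n : ℕ} {α : ℝ}

theorem integrable_japanese {s : ℝ} (hs : (n : ℝ) < s) :
    Integrable (fun y : EuclideanSpace ℝ (Fin n) => (1 + ‖y‖) ^ (-s)) :=
  integrable_one_add_norm (by simpa using hs)

theorem integrable_near_kernel (hn : 1 ≤ n) (hα2 : α < 2) :
    Integrable ((closedBall (0 : EuclideanSpace ℝ (Fin n)) 1).indicator
      (fun y => ‖y‖ ^ 2 * ‖y‖ ^ (-((n : ℝ) + α)))) := by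
  have : Nontrivial (EuclideanSpace ℝ (Fin n)) := by
    have : Nonempty (Fin n) := ⟨⟨0, hn⟩⟩
    infer_instance
  have key : Integrable (fun y : EuclideanSpace ℝ (Fin n) =>
      (Set.Iic (1 : ℝ)).indicator (fun t => t ^ 2 * t ^ (-((n : ℝ) + α))) ‖y‖) := by
    rw [integrable_fun_norm_addHaar volume
      (f := (Set.Iic (1 : ℝ)).indicator (fun t => t ^ 2 * t ^ (-((n : ℝ) + α))))]
    have h1 : IntegrableOn (fun t : ℝ => t ^ (1 - α)) (Set.Ioc 0 1) := by
      rw [← intervalIntegrable_iff_integrableOn_Ioc_of_le zero_le_one]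
      exact intervalIntegral.intervalIntegrable_rpow' (by linarith)
    have h2 : IntegrableOn (fun t : ℝ => (Set.Ioc 0 1).indicator (fun t => t ^ (1 - α)) t)
        (Set.Ioi 0) :=
      (h1.integrable_indicator measurableSet_Ioc).integrableOn
    refine h2.congr_fun (fun t ht => ?_) measurableSet_Ioi
    have ht : 0 < t := ht
    by_cases h : t ≤ 1
    · beta_reduce
      rw [Set.indicator_of_mem (show t ∈ Set.Ioc 0 1 from ⟨ht, h⟩)]
      simp only [finrank_euclideanSpace_fin, smul_eq_mul]
      rw [Set.indicator_of_mem (show t ∈ Set.Iic 1 from h), ← Real.rpow_natCast t (n - 1),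
        ← Real.rpow_natCast t 2, ← Real.rpow_add ht, ← Real.rpow_add ht]
      congr 1
      push_cast [Nat.cast_sub hn]
      ring
    · simp [h]
  refine key.congr (Eventually.of_forall fun y => ?_)
  beta_reduce
  by_cases h : ‖y‖ ≤ 1
  · rw [Set.indicator_of_mem (by simpa using h), Set.indicator_of_mem (by simpa using h)]
  · rw [Set.indicator_of_notMem (by simpa using h), Set.indicator_of_notMem (by simpa using h)]

/-- The `x`-dependent dominating function for second-difference quotients. -/
def domFun (n : ℕ) (α : ℝ) (x y : EuclideanSpace ℝ (Fin n)) : ℝ :=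
  (closedBall (0 : EuclideanSpace ℝ (Fin n)) 1).indicator
      (fun y => ‖y‖ ^ 2 * ‖y‖ ^ (-((n : ℝ) + α))) y +
    2 ^ ((n : ℝ) + α) * ((1 + ‖y‖) ^ (-((n : ℝ) + α)) + (1 + ‖y‖) ^ (-((n : ℝ) + α)) +
      (1 + ‖x + y‖) ^ (-((n : ℝ) + 2 - α)) + (1 + ‖x - y‖) ^ (-((n : ℝ) + 2 - α)))

theorem domFun_nonneg (x y : EuclideanSpace ℝ (Fin n)) : 0 ≤ domFun n α x y := by
  refine add_nonneg (Set.indicator_nonneg (fun y _ => by positivity) _) (by positivity)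

theorem integrable_domFun (hn : 1 ≤ n) (hα0 : 0 < α) (hα2 : α < 2)
    (x : EuclideanSpace ℝ (Fin n)) : Integrable (domFun n α x) := by
  have h1 := integrable_japanese (n := n) (s := n + α) (by linarith)
  have h2 := integrable_japanese (n := n) (s := n + 2 - α) (by linarith)
  exact (integrable_near_kernel hn hα2).add
    ((((h1.add h1).add (h2.comp_add_left x)).add (h2.comp_sub_left x)).const_mul _)

theorem integral_domFun (hn : 1 ≤ n) (hα0 : 0 < α) (hα2 : α < 2)
    (x : EuclideanSpace ℝ (Fin n)) :
    ∫ y, domFun n α x y = ∫ y, domFun n α (0 : EuclideanSpace ℝ (Fin n)) y := by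
  have h1 := integrable_japanese (n := n) (s := n + α) (by linarith)
  have h2 := integrable_japanese (n := n) (s := n + 2 - α) (by linarith)
  have key : ∀ x : EuclideanSpace ℝ (Fin n), ∫ y, domFun n α x y =
      (∫ y, (closedBall (0 : EuclideanSpace ℝ (Fin n)) 1).indicator
        (fun y => ‖y‖ ^ 2 * ‖y‖ ^ (-((n : ℝ) + α))) y) +
      2 ^ ((n : ℝ) + α) * (((∫ y : EuclideanSpace ℝ (Fin n), (1 + ‖y‖) ^ (-((n : ℝ) + α))) +
        (∫ y : EuclideanSpace ℝ (Fin n), (1 + ‖y‖) ^ (-((n : ℝ) + α)))) +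
        (∫ y : EuclideanSpace ℝ (Fin n), (1 + ‖y‖) ^ (-((n : ℝ) + 2 - α))) +
        ∫ y : EuclideanSpace ℝ (Fin n), (1 + ‖y‖) ^ (-((n : ℝ) + 2 - α))) := by
    intro x
    have e1 := integral_add_left_eq_self
      (fun y : EuclideanSpace ℝ (Fin n) => (1 + ‖y‖) ^ (-((n : ℝ) + 2 - α))) (μ := volume) x
    have e2 := integral_sub_left_eq_self
      (fun y : EuclideanSpace ℝ (Fin n) => (1 + ‖y‖) ^ (-((n : ℝ) + 2 - α))) volume x
    have i1 : Integrable (fun y : EuclideanSpace ℝ (Fin n) =>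
      (1 + ‖y‖) ^ (-((n : ℝ) + α)) + (1 + ‖y‖) ^ (-((n : ℝ) + α))) := h1.add h1
    have i2 : Integrable (fun y : EuclideanSpace ℝ (Fin n) => (1 + ‖y‖) ^ (-((n : ℝ) + α)) +
      (1 + ‖y‖) ^ (-((n : ℝ) + α)) + (1 + ‖x + y‖) ^ (-((n : ℝ) + 2 - α))) :=
      i1.add (h2.comp_add_left x)
    have i3 := (i2.add (h2.comp_sub_left x)).const_mul (2 ^ ((n : ℝ) + α))
    simp only [Pi.add_apply] at i3
    unfold domFun
    rw [integral_add (integrable_near_kernel hn hα2) i3, integral_const_mul,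
      integral_add i2 (h2.comp_sub_left x), integral_add i1 (h2.comp_add_left x),
      integral_add h1 h1, e1, e2]
  rw [key x, key 0]

theorem norm_rpow_neg_le_of_one_lt {p : ℝ} (hp : 0 ≤ p) {y : EuclideanSpace ℝ (Fin n)}
    (hy : 1 < ‖y‖) : ‖y‖ ^ (-p) ≤ 2 ^ p * (1 + ‖y‖) ^ (-p) := by
  have h0 : 0 < ‖y‖ := by linarith
  rw [Real.rpow_neg h0.le, Real.rpow_neg (by positivity), ← div_eq_mul_inv, inv_eq_one_div,
    div_le_div_iff₀ (by positivity) (by positivity), one_mul,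
    ← Real.mul_rpow (by norm_num) h0.le]
  exact Real.rpow_le_rpow (by positivity) (by linarith) hp

theorem one_add_rpow_mul_le {p N : ℝ} (hp : 0 ≤ p) (x z : EuclideanSpace ℝ (Fin n)) :
    (1 + ‖z‖) ^ (-N) * (1 + ‖x - z‖) ^ (-p) ≤ (1 + ‖x‖) ^ (-p) * (1 + ‖z‖) ^ (-(N - p)) := by
  have h := one_add_norm_rpow_neg_le hp x (x - z)
  rw [sub_sub_cancel] at h
  calc (1 + ‖z‖) ^ (-N) * (1 + ‖x - z‖) ^ (-p)
      ≤ (1 + ‖z‖) ^ (-N) * ((1 + ‖z‖) ^ p * (1 + ‖x‖) ^ (-p)) := by gcongr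
    _ = _ := by
      rw [neg_sub, sub_eq_add_neg, Real.rpow_add (by positivity)]; ring

variable {F : Type*} [NormedAddCommGroup F]

theorem DecayBound.nonneg {N A : ℝ} {φ : EuclideanSpace ℝ (Fin n) → F}
    (h : DecayBound N A φ) : 0 ≤ A := by
  have := (norm_nonneg _).trans (h.bound 0)
  simpa using this

theorem DecayBound.norm_secondDiff_mul_le (hα0 : 0 < α) (hα2 : α < 2) {A : ℝ}
    {φ : EuclideanSpace ℝ (Fin n) → F} (h : DecayBound (2 * n + 2) A φ)
    (x y : EuclideanSpace ℝ (Fin n)) :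
    ‖secondDiff φ x y‖ * ‖y‖ ^ (-((n : ℝ) + α)) ≤
      A * (1 + ‖x‖) ^ (-((n : ℝ) + α)) * domFun n α x y := by
  have hA := h.nonneg
  have hp : (0 : ℝ) ≤ n + α := by positivity
  have hwle : (1 + ‖x‖) ^ (-(2 * (n : ℝ) + 2)) ≤ (1 + ‖x‖) ^ (-((n : ℝ) + α)) := by
    refine Real.rpow_le_rpow_of_exponent_le (by linarith [norm_nonneg x]) ?_
    have : (0 : ℝ) ≤ n := by positivity
    linarith
  unfold domFun
  by_cases hy : ‖y‖ ≤ 1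
  · rw [Set.indicator_of_mem (by simpa using hy)]
    calc ‖secondDiff φ x y‖ * ‖y‖ ^ (-((n : ℝ) + α))
        ≤ (A * ‖y‖ ^ 2 * (1 + ‖x‖) ^ (-(2 * (n : ℝ) + 2))) * ‖y‖ ^ (-((n : ℝ) + α)) := by
          gcongr; exact h.diff2 x y hy
      _ ≤ (A * ‖y‖ ^ 2 * (1 + ‖x‖) ^ (-((n : ℝ) + α))) * ‖y‖ ^ (-((n : ℝ) + α)) := by gcongr
      _ = A * (1 + ‖x‖) ^ (-((n : ℝ) + α)) * (‖y‖ ^ 2 * ‖y‖ ^ (-((n : ℝ) + α))) := by ring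
      _ ≤ _ := by
        gcongr
        exact le_add_of_nonneg_right (by positivity)
  · rw [Set.indicator_of_notMem (by simpa using hy), zero_add]
    push Not at hy
    have h3 : ‖secondDiff φ x y‖ ≤ A * ((1 + ‖x‖) ^ (-(2 * (n : ℝ) + 2)) +
        (1 + ‖x‖) ^ (-(2 * (n : ℝ) + 2)) + (1 + ‖x + y‖) ^ (-(2 * (n : ℝ) + 2)) +
        (1 + ‖x - y‖) ^ (-(2 * (n : ℝ) + 2))) := by
      unfold secondDiff
      linarith [norm_sub_le (φ x + φ x - φ (x + y)) (φ (x - y)),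
        norm_sub_le (φ x + φ x) (φ (x + y)), norm_add_le (φ x) (φ x), h.bound x,
        h.bound (x + y), h.bound (x - y)]
    have e1 : (-((2 * (n : ℝ) + 2) - (n + α))) = -((n : ℝ) + 2 - α) := by ring
    have q1 := one_add_rpow_mul_le (N := 2 * (n : ℝ) + 2) hp x (x + y)
    have q2 := one_add_rpow_mul_le (N := 2 * (n : ℝ) + 2) hp x (x - y)
    rw [e1] at q1 q2
    rw [show x - (x + y) = -y by abel, norm_neg] at q1
    rw [show x - (x - y) = y by abel] at q2
    calc ‖secondDiff φ x y‖ * ‖y‖ ^ (-((n : ℝ) + α))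
        ≤ (A * ((1 + ‖x‖) ^ (-(2 * (n : ℝ) + 2)) +
        (1 + ‖x‖) ^ (-(2 * (n : ℝ) + 2)) + (1 + ‖x + y‖) ^ (-(2 * (n : ℝ) + 2)) +
        (1 + ‖x - y‖) ^ (-(2 * (n : ℝ) + 2)))) *
          (2 ^ ((n : ℝ) + α) * (1 + ‖y‖) ^ (-((n : ℝ) + α))) := by
          gcongr
          exact norm_rpow_neg_le_of_one_lt hp hy
      _ = A * 2 ^ ((n : ℝ) + α) * ((1 + ‖x‖) ^ (-(2 * (n : ℝ) + 2)) * (1 + ‖y‖) ^ (-((n : ℝ) + α))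
          + (1 + ‖x‖) ^ (-(2 * (n : ℝ) + 2)) * (1 + ‖y‖) ^ (-((n : ℝ) + α)) +
          (1 + ‖x + y‖) ^ (-(2 * (n : ℝ) + 2)) * (1 + ‖y‖) ^ (-((n : ℝ) + α)) +
          (1 + ‖x - y‖) ^ (-(2 * (n : ℝ) + 2)) * (1 + ‖y‖) ^ (-((n : ℝ) + α))) := by ring
      _ ≤ A * 2 ^ ((n : ℝ) + α) * ((1 + ‖x‖) ^ (-((n : ℝ) + α)) * (1 + ‖y‖) ^ (-((n : ℝ) + α))
          + (1 + ‖x‖) ^ (-((n : ℝ) + α)) * (1 + ‖y‖) ^ (-((n : ℝ) + α)) +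
          (1 + ‖x‖) ^ (-((n : ℝ) + α)) * (1 + ‖x + y‖) ^ (-((n : ℝ) + 2 - α)) +
          (1 + ‖x‖) ^ (-((n : ℝ) + α)) * (1 + ‖x - y‖) ^ (-((n : ℝ) + 2 - α))) := by gcongr
      _ = _ := by ring

end Kernel

section FracLap

variable {n : ℕ} {α : ℝ}

theorem continuous_secondDiff {E F : Type*} [NormedAddCommGroup E]
    [NormedAddCommGroup F] {φ : E → F} (hφ : Continuous φ) :
    Continuous fun p : E × E => secondDiff φ p.1 p.2 := by
  unfold secondDiff
  fun_prop

theorem DecayBound.norm_le {F : Type*} [NormedAddCommGroup F] {N A : ℝ} (hN : 0 ≤ N)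
    {φ : EuclideanSpace ℝ (Fin n) → F} (h : DecayBound N A φ) (x : EuclideanSpace ℝ (Fin n)) : ‖φ x‖ ≤ A := by
  refine (h.bound x).trans (mul_le_of_le_one_right h.nonneg ?_)
  exact Real.rpow_le_one_of_one_le_of_nonpos (by linarith [norm_nonneg x]) (by linarith)

/-- Twice the (unnormalized) fractional Laplacian, as an absolutely convergent integral of
second differences. -/
def secondDiffLap {F : Type*} [NormedAddCommGroup F] [NormedSpace ℝ F] (n : ℕ) (α : ℝ)
    (φ : EuclideanSpace ℝ (Fin n) → F) (x : EuclideanSpace ℝ (Fin n)) : F :=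
  ∫ y, ‖y‖ ^ (-((n : ℝ) + α)) • secondDiff φ x y

variable {F : Type*} [NormedAddCommGroup F] [NormedSpace ℝ F]

theorem stronglyMeasurable_secondDiffLap {φ : EuclideanSpace ℝ (Fin n) → F} (hφ : Continuous φ) :
    StronglyMeasurable (secondDiffLap n α φ) := by
  have h : StronglyMeasurable fun p : EuclideanSpace ℝ (Fin n) × EuclideanSpace ℝ (Fin n) =>
      ‖p.2‖ ^ (-((n : ℝ) + α)) • secondDiff φ p.1 p.2 := by
    refine StronglyMeasurable.smul ?_ (continuous_secondDiff hφ).stronglyMeasurable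
    exact (measurable_snd.norm.pow_const _).stronglyMeasurable
  exact h.integral_prod_right (ν := volume)

theorem DecayBound.integrable_secondDiff (hn : 1 ≤ n) (hα0 : 0 < α) (hα2 : α < 2) {A : ℝ}
    {φ : EuclideanSpace ℝ (Fin n) → F} (h : DecayBound (2 * n + 2) A φ)
    (x : EuclideanSpace ℝ (Fin n)) :
    Integrable fun y => ‖y‖ ^ (-((n : ℝ) + α)) • secondDiff φ x y := by
  refine ((integrable_domFun hn hα0 hα2 x).const_mul
    (A * (1 + ‖x‖) ^ (-((n : ℝ) + α)))).mono' ?_ (Eventually.of_forall fun y => ?_)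
  · refine AEStronglyMeasurable.smul ?_ ?_
    · exact (measurable_norm.pow_const _).aestronglyMeasurable
    · exact ((continuous_secondDiff h.cont).comp (Continuous.prodMk_right x)).aestronglyMeasurable
  · rw [norm_smul, Real.norm_of_nonneg (by positivity), mul_comm]
    exact h.norm_secondDiff_mul_le hα0 hα2 x y

theorem DecayBound.norm_secondDiffLap_le (hn : 1 ≤ n) (hα0 : 0 < α) (hα2 : α < 2) {A : ℝ}
    {φ : EuclideanSpace ℝ (Fin n) → F} (h : DecayBound (2 * n + 2) A φ)
    (x : EuclideanSpace ℝ (Fin n)) :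
    ‖secondDiffLap n α φ x‖ ≤ A * (∫ y, domFun n α (0 : EuclideanSpace ℝ (Fin n)) y) *
      (1 + ‖x‖) ^ (-((n : ℝ) + α)) := by
  refine (norm_integral_le_of_norm_le ((integrable_domFun hn hα0 hα2 x).const_mul
    (A * (1 + ‖x‖) ^ (-((n : ℝ) + α)))) (Eventually.of_forall fun y => ?_)).trans_eq ?_
  · rw [norm_smul, Real.norm_of_nonneg (by positivity), mul_comm]
    exact h.norm_secondDiff_mul_le hα0 hα2 x y
  · rw [integral_const_mul, integral_domFun hn hα0 hα2]
    ring

theorem tendsto_secondDiffLap (hn : 1 ≤ n) (hα0 : 0 < α) (hα2 : α < 2) {A : ℝ}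
    {φ : ℕ → EuclideanSpace ℝ (Fin n) → F} {ψ : EuclideanSpace ℝ (Fin n) → F}
    (h : ∀ k, DecayBound (2 * n + 2) A (φ k))
    (hlim : ∀ x, Tendsto (fun k => φ k x) atTop (𝓝 (ψ x))) (x : EuclideanSpace ℝ (Fin n)) :
    Tendsto (fun k => secondDiffLap n α (φ k) x) atTop (𝓝 (secondDiffLap n α ψ x)) := by
  refine tendsto_integral_of_dominated_convergence _
    (fun k => ((h k).integrable_secondDiff hn hα0 hα2 x).aestronglyMeasurable)
    ((integrable_domFun hn hα0 hα2 x).const_mul (A * (1 + ‖x‖) ^ (-((n : ℝ) + α))))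
    (fun k => Eventually.of_forall fun y => ?_) (Eventually.of_forall fun y => ?_)
  · rw [norm_smul, Real.norm_of_nonneg (by positivity), mul_comm]
    exact (h k).norm_secondDiff_mul_le hα0 hα2 x y
  · exact ((((hlim x).add (hlim x)).sub (hlim (x + y))).sub (hlim (x - y))).const_smul _

/-- Averaging a difference quotient over `±y` against an even kernel. -/
theorem two_mul_integral_even_kernel {k φ : EuclideanSpace ℝ (Fin n) → ℝ} (hk : Integrable k)
    (hk' : ∀ y, k (-y) = k y) (hφ : Continuous φ) {C : ℝ} (hC : ∀ x, ‖φ x‖ ≤ C)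
    (x : EuclideanSpace ℝ (Fin n)) :
    2 * ∫ z, k (x - z) * (φ x - φ z) = ∫ y, k y * secondDiff φ x y := by
  have e1 : ∫ z, k (x - z) * (φ x - φ z) = ∫ y, k y * (φ x - φ (x - y)) := by
    rw [← integral_sub_left_eq_self (fun z => k (x - z) * (φ x - φ z)) volume x]
    simp
  have e2 : ∫ y, k y * (φ x - φ (x - y)) = ∫ y, k y * (φ x - φ (x + y)) := by
    rw [← integral_neg_eq_self (fun y => k y * (φ x - φ (x - y)))]
    simp [hk']
  have hb : ∀ z, ‖φ x - φ z‖ ≤ C + C := fun z =>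
    (norm_sub_le _ _).trans (add_le_add (hC _) (hC _))
  have i1 : Integrable (fun y => k y * (φ x - φ (x - y))) :=
    hk.mul_bdd (by fun_prop) (Eventually.of_forall fun y => hb _)
  have i2 : Integrable (fun y => k y * (φ x - φ (x + y))) :=
    hk.mul_bdd (by fun_prop) (Eventually.of_forall fun y => hb _)
  rw [two_mul, e1]
  nth_rewrite 1 [e2]
  rw [← integral_add i2 i1]
  refine integral_congr_ae (Eventually.of_forall fun y => ?_)
  simp only [secondDiff]
  ring

theorem norm_rpow_neg_le_of_lt {ε p : ℝ} (hε : 0 < ε) (hp : 0 ≤ p)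
    {y : EuclideanSpace ℝ (Fin n)} (hy : ε < ‖y‖) :
    ‖y‖ ^ (-p) ≤ (1 + ε⁻¹) ^ p * (1 + ‖y‖) ^ (-p) := by
  have h0 : 0 < ‖y‖ := hε.trans hy
  rw [Real.rpow_neg h0.le, Real.rpow_neg (by positivity), ← div_eq_mul_inv, inv_eq_one_div,
    div_le_div_iff₀ (by positivity) (by positivity), one_mul,
    ← Real.mul_rpow (by positivity) h0.le]
  refine Real.rpow_le_rpow (by positivity) ?_ hp
  have : 1 ≤ ε⁻¹ * ‖y‖ := by
    rw [inv_mul_eq_div, one_le_div hε]; exact hy.le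
  linarith

theorem integrable_truncated_kernel (hα0 : 0 < α) {ε : ℝ} (hε : 0 < ε) :
    Integrable ({y : EuclideanSpace ℝ (Fin n) | ε < ‖y‖}.indicator
      fun y => ‖y‖ ^ (-((n : ℝ) + α))) := by
  have hm : MeasurableSet {y : EuclideanSpace ℝ (Fin n) | ε < ‖y‖} :=
    measurableSet_lt measurable_const measurable_norm
  refine ((integrable_japanese (n := n) (s := n + α) (by linarith)).const_mul
    ((1 + ε⁻¹) ^ ((n : ℝ) + α))).mono'
    ((measurable_norm.pow_const _).indicator hm).aestronglyMeasurable
    (Eventually.of_forall fun y => ?_)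
  by_cases hy : ε < ‖y‖
  · rw [Set.indicator_of_mem (by exact hy), Real.norm_of_nonneg (by positivity)]
    exact norm_rpow_neg_le_of_lt hε (by positivity) hy
  · rw [Set.indicator_of_notMem (by exact hy), norm_zero]
    positivity

theorem DecayBound.isFracLapAt (hn : 1 ≤ n) (hα0 : 0 < α) (hα2 : α < 2) {A : ℝ}
    {φ : EuclideanSpace ℝ (Fin n) → ℝ} (h : DecayBound (2 * n + 2) A φ)
    (x : EuclideanSpace ℝ (Fin n)) :
    IsFracLapAt n α φ x (secondDiffLap n α φ x / 2) := by
  have hm : ∀ ε : ℝ, MeasurableSet {y : EuclideanSpace ℝ (Fin n) | ε < ‖y‖} := fun ε =>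
    measurableSet_lt measurable_const measurable_norm
  let k : ℝ → EuclideanSpace ℝ (Fin n) → ℝ := fun ε =>
    {y : EuclideanSpace ℝ (Fin n) | ε < ‖y‖}.indicator fun y => ‖y‖ ^ (-((n : ℝ) + α))
  have hk : ∀ ε > 0, ∫ z in {z : EuclideanSpace ℝ (Fin n) | ε < ‖x - z‖},
      (φ x - φ z) / ‖x - z‖ ^ ((n : ℝ) + α) = (∫ y, k ε y * secondDiff φ x y) / 2 := by
    intro ε hε
    rw [← two_mul_integral_even_kernel (integrable_truncated_kernel hα0 hε) (fun y => ?_) h.cont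
      (h.norm_le (by positivity)) x, mul_div_cancel_left₀ _ two_ne_zero,
      ← integral_indicator (measurableSet_lt measurable_const (by fun_prop))]
    · refine integral_congr_ae (Eventually.of_forall fun z => ?_)
      by_cases hz : ε < ‖x - z‖
      · beta_reduce
        rw [Set.indicator_of_mem (by exact hz), Set.indicator_of_mem (by exact hz),
          Real.rpow_neg (norm_nonneg _), div_eq_mul_inv, mul_comm]
      · beta_reduce
        rw [Set.indicator_of_notMem (by exact hz), Set.indicator_of_notMem (by exact hz), zero_mul]
    · simp [Set.indicator_apply]
  have hlim : Tendsto (fun ε => ∫ y, k ε y * secondDiff φ x y) (𝓝[>] 0)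
      (𝓝 (secondDiffLap n α φ x)) := by
    refine tendsto_integral_filter_of_dominated_convergence
      (fun y => A * (1 + ‖x‖) ^ (-((n : ℝ) + α)) * domFun n α x y)
      (Eventually.of_forall fun ε => ?_) (Eventually.of_forall fun ε => Eventually.of_forall
        fun y => ?_) ((integrable_domFun hn hα0 hα2 x).const_mul _)
        (Eventually.of_forall fun y => ?_)
    · exact (((measurable_norm.pow_const _).indicator (hm ε)).aestronglyMeasurable).mul
        ((continuous_secondDiff h.cont).comp (Continuous.prodMk_right x)).aestronglyMeasurable
    · refine le_trans ?_ (h.norm_secondDiff_mul_le hα0 hα2 x y)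
      rw [norm_mul, mul_comm]
      gcongr
      refine (norm_indicator_le_norm_self _ _).trans_eq ?_
      exact Real.norm_of_nonneg (by positivity)
    · rcases eq_or_ne y 0 with rfl | hy
      · simp [secondDiff]
      · refine tendsto_const_nhds.congr' ?_
        filter_upwards [Ioo_mem_nhdsGT (norm_pos_iff.2 hy)] with ε hε
        simp only [k]
        rw [Set.indicator_of_mem (by exact hε.2), smul_eq_mul]
  refine (hlim.div_const 2).congr' ?_
  filter_upwards [self_mem_nhdsWithin] with ε hε
  exact (hk ε hε).symm

end FracLap

section Cutoff

variable {n : ℕ} {α : ℝ}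

theorem rpow_neg_two_mul_add_two (n : ℕ) {t : ℝ} (ht : 0 < t) :
    t ^ (-(2 * (n : ℝ) + 2)) = (t ^ (2 * n + 2))⁻¹ := by
  rw [Real.rpow_neg ht.le, ← Real.rpow_natCast]
  push_cast
  rfl

theorem SchwartzMap.exists_iteratedFDeriv_le {F : Type*} [NormedAddCommGroup F] [NormedSpace ℝ F]
    (f : SchwartzMap (EuclideanSpace ℝ (Fin n)) F) :
    ∃ A : ℝ, 0 ≤ A ∧ ∀ i ≤ 2, ∀ x, ‖iteratedFDeriv ℝ i f x‖ ≤
      A * (1 + ‖x‖) ^ (-(2 * (n : ℝ) + 2)) := by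
  refine ⟨2 ^ (2 * n + 2) * (Finset.Iic (2 * n + 2, 2)).sup
    (fun m => SchwartzMap.seminorm ℝ m.1 m.2) f, by positivity, fun i hi x => ?_⟩
  rw [rpow_neg_two_mul_add_two n (by positivity), ← div_eq_mul_inv, le_div_iff₀ (by positivity),
    mul_comm]
  exact SchwartzMap.one_add_le_sup_seminorm_apply (𝕜 := ℝ) (m := (2 * n + 2, 2)) le_rfl hi f x

theorem SchwartzMap.exists_decayBound {F : Type*} [NormedAddCommGroup F] [NormedSpace ℝ F]
    (f : SchwartzMap (EuclideanSpace ℝ (Fin n)) F) : ∃ A, DecayBound (2 * n + 2) A f := by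
  obtain ⟨A, -, hA⟩ := f.exists_iteratedFDeriv_le
  exact ⟨_, DecayBound.of_contDiff (f.smooth 2) (by positivity)
    (fun x => by simpa using hA 0 (by norm_num) x) (hA 2 le_rfl)⟩

theorem exists_iteratedFDeriv_bound_of_hasCompactSupport {g : EuclideanSpace ℝ (Fin n) → ℝ}
    (hg : ContDiff ℝ (⊤ : ℕ∞) g) (hc : HasCompactSupport g) :
    ∃ M : ℝ, ∀ i ≤ 2, ∀ x, ‖iteratedFDeriv ℝ i g x‖ ≤ M := by
  obtain ⟨A, hA0, hA⟩ := (hc.toSchwartzMap hg).exists_iteratedFDeriv_le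
  refine ⟨A, fun i hi x => (hA i hi x).trans (mul_le_of_le_one_right hA0 ?_)⟩
  refine Real.rpow_le_one_of_one_le_of_nonpos (by linarith [norm_nonneg x]) ?_
  have : (0 : ℝ) ≤ n := by positivity
  linarith

/-- Compactly supported truncations of a Schwartz function, with uniform decay bounds. -/
theorem SchwartzMap.exists_truncation (f : SchwartzMap (EuclideanSpace ℝ (Fin n)) ℝ) :
    ∃ (A : ℝ) (φ : ℕ → EuclideanSpace ℝ (Fin n) → ℝ),
      (∀ k, ContDiff ℝ (⊤ : ℕ∞) (φ k)) ∧ (∀ k, HasCompactSupport (φ k)) ∧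
      (∀ k, DecayBound (2 * n + 2) A (φ k)) ∧
      ∀ x, Tendsto (fun k => φ k x) atTop (𝓝 (f x)) := by
  let g : ContDiffBump (0 : EuclideanSpace ℝ (Fin n)) := ⟨1, 2, one_pos, one_lt_two⟩
  obtain ⟨A, hA0, hA⟩ := f.exists_iteratedFDeriv_le
  obtain ⟨M, hM⟩ := exists_iteratedFDeriv_bound_of_hasCompactSupport g.contDiff g.hasCompactSupport
  have hM0 : 0 ≤ M := (norm_nonneg _).trans (hM 0 (by norm_num) 0)
  let t : ℕ → ℝ := fun k => 1 / ((k : ℝ) + 1)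
  have ht0 : ∀ k, 0 < t k := fun k => by positivity
  have ht1 : ∀ k, t k ≤ 1 := fun k => by
    have : (0 : ℝ) ≤ k := by positivity
    exact (div_le_one (by positivity)).2 (by linarith)
  have hs : ∀ k, ContDiff ℝ (⊤ : ℕ∞) fun x : EuclideanSpace ℝ (Fin n) => g (t k • x) := fun k =>
    g.contDiff.comp (contDiff_const_smul _)
  have hb : ∀ k, ∀ i ≤ 2, ∀ x,
      ‖iteratedFDeriv ℝ i (fun x : EuclideanSpace ℝ (Fin n) => g (t k • x)) x‖ ≤ M := by
    intro k i hi x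
    rw [iteratedFDeriv_comp_const_smul (t k) g.contDiff, norm_smul, norm_pow,
      Real.norm_of_nonneg (ht0 k).le]
    exact (mul_le_of_le_one_left (norm_nonneg _) (pow_le_one₀ (ht0 k).le (ht1 k))).trans
      (hM i hi _)
  refine ⟨_, fun k x => g (t k • x) * f x, fun k => (hs k).mul (f.smooth _), fun k => ?_,
    fun k => DecayBound.of_contDiff (A := 4 * M * A) (((hs k).mul (f.smooth _)).of_le ?_)
      (by positivity) (fun x => ?_) (fun x => ?_), fun x => ?_⟩
  · exact (g.hasCompactSupport.comp_smul (ht0 k).ne').mul_right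
  · exact WithTop.coe_le_coe.2 le_top
  · have h1 : |g (t k • x)| ≤ M := by simpa using hM 0 (by norm_num) (t k • x)
    have h2 : ‖f x‖ ≤ A * (1 + ‖x‖) ^ (-(2 * (n : ℝ) + 2)) := by
      simpa using hA 0 (by norm_num) x
    rw [norm_mul, Real.norm_eq_abs]
    calc |g (t k • x)| * ‖f x‖ ≤ M * (A * (1 + ‖x‖) ^ (-(2 * (n : ℝ) + 2))) := by gcongr
      _ ≤ 4 * (M * (A * (1 + ‖x‖) ^ (-(2 * (n : ℝ) + 2)))) := by
        have : 0 ≤ M * (A * (1 + ‖x‖) ^ (-(2 * (n : ℝ) + 2))) := by positivity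
        linarith
      _ = _ := by ring
  · refine (norm_iteratedFDeriv_mul_le (hs k) (f.smooth ⊤) x (n := 2)
      (WithTop.coe_le_coe.2 le_top)).trans ?_
    have hsum : ∑ i ∈ Finset.range (2 + 1), ((2 : ℕ).choose i : ℝ) * M *
        (A * (1 + ‖x‖) ^ (-(2 * (n : ℝ) + 2))) = 4 * M * A * (1 + ‖x‖) ^ (-(2 * (n : ℝ) + 2)) := by
      simp only [Finset.sum_range_succ, Finset.sum_range_zero]
      norm_num
      ring
    rw [← hsum]
    refine Finset.sum_le_sum fun i hi => ?_
    have hi2 : i ≤ 2 := Nat.lt_succ_iff.1 (Finset.mem_range.1 hi)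
    gcongr
    · exact hb k i hi2 x
    · exact hA _ (Nat.sub_le _ _) x
  · have h0 : Tendsto t atTop (𝓝 0) := tendsto_one_div_add_atTop_nhds_zero_nat
    have h1 : Tendsto (fun k => t k • x) atTop (𝓝 0) := by simpa using h0.smul_const x
    have h2 := (g.continuous.tendsto 0).comp h1
    have h3 : g 0 = 1 := g.one_of_mem_closedBall (mem_closedBall_self zero_le_one)
    rw [h3] at h2
    simpa using h2.mul_const (f x)

end Cutoff

section Pairing

variable {n : ℕ} {α : ℝ}

theorem InLalpha.aestronglyMeasurable {u : EuclideanSpace ℝ (Fin n) → ℝ} (hα0 : 0 < α)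
    (hu : InLalpha n α u) : AEStronglyMeasurable u := by
  have h1 : Continuous fun x : EuclideanSpace ℝ (Fin n) => 1 + ‖x‖ ^ ((n : ℝ) + α) :=
    continuous_const.add (continuous_norm.rpow_const fun x => Or.inr (by positivity))
  refine ((Integrable.aestronglyMeasurable hu).mul h1.aestronglyMeasurable).congr
    (Eventually.of_forall fun x => ?_)
  simp only [Pi.mul_apply]
  exact div_mul_cancel₀ _ (by positivity)

theorem one_add_rpow_le {p t : ℝ} (hp : 0 ≤ p) (ht : 0 ≤ t) : 1 + t ^ p ≤ 2 * (1 + t) ^ p := by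
  have h1 : (1 : ℝ) ≤ (1 + t) ^ p := Real.one_le_rpow (by linarith) hp
  have h2 : t ^ p ≤ (1 + t) ^ p := Real.rpow_le_rpow ht (by linarith) hp
  linarith

theorem rpow_one_add_le {p t : ℝ} (hp : 0 ≤ p) (ht : 0 ≤ t) :
    (1 + t) ^ p ≤ 2 ^ p * (1 + t ^ p) := by
  rcases le_total t 1 with h | h
  · have h1 : (1 + t) ^ p ≤ 2 ^ p := Real.rpow_le_rpow (by linarith) (by linarith) hp
    have h2 : 0 ≤ (2 : ℝ) ^ p * t ^ p := by positivity
    linarith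
  · have h1 : (1 + t) ^ p ≤ (2 * t) ^ p := Real.rpow_le_rpow (by linarith) (by linarith) hp
    rw [Real.mul_rpow (by norm_num) ht] at h1
    have h2 : 0 ≤ (2 : ℝ) ^ p := by positivity
    linarith

theorem InLalpha.integrable_mul_japanese {u : EuclideanSpace ℝ (Fin n) → ℝ} (hα0 : 0 < α)
    (hu : InLalpha n α u) :
    Integrable fun x => ‖u x‖ * (1 + ‖x‖) ^ (-((n : ℝ) + α)) := by
  have hp : (0 : ℝ) ≤ n + α := by positivity
  refine ((Integrable.norm hu).const_mul 2).mono' ((hu.aestronglyMeasurable hα0).norm.mul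
    ((measurable_norm.const_add 1).pow_const _).aestronglyMeasurable)
    (Eventually.of_forall fun x => ?_)
  have h0 : 0 < 1 + ‖x‖ := by positivity
  have h1 : 0 < 1 + ‖x‖ ^ ((n : ℝ) + α) := by positivity
  rw [norm_mul, norm_norm, norm_div, Real.norm_of_nonneg (Real.rpow_nonneg h0.le _),
    Real.norm_of_nonneg h1.le, Real.rpow_neg h0.le, div_eq_mul_inv, ← mul_assoc, mul_comm 2,
    mul_assoc]
  gcongr
  rw [inv_eq_one_div, ← div_eq_mul_inv, div_le_div_iff₀ (by positivity) h1, one_mul]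
  exact one_add_rpow_le hp (norm_nonneg x)

theorem InLalpha.integrable_mul {u f : EuclideanSpace ℝ (Fin n) → ℝ} (hα0 : 0 < α)
    (hu : InLalpha n α u) (hf : AEStronglyMeasurable f) {C : ℝ}
    (hC : ∀ x, ‖f x‖ ≤ C * (1 + ‖x‖) ^ (-((n : ℝ) + α))) : Integrable fun x => u x * f x := by
  refine ((hu.integrable_mul_japanese hα0).const_mul C).mono'
    ((hu.aestronglyMeasurable hα0).mul hf) (Eventually.of_forall fun x => ?_)
  rw [norm_mul]
  calc ‖u x‖ * ‖f x‖ ≤ ‖u x‖ * (C * (1 + ‖x‖) ^ (-((n : ℝ) + α))) := by gcongr; exact hC x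
    _ = _ := by ring

theorem InLalpha.of_integrable_mul_japanese {u : EuclideanSpace ℝ (Fin n) → ℝ} (hα0 : 0 < α)
    (hm : AEStronglyMeasurable u)
    (hu : Integrable fun x => ‖u x‖ * (1 + ‖x‖) ^ (-((n : ℝ) + α))) : InLalpha n α u := by
  have hp : (0 : ℝ) ≤ n + α := by positivity
  refine (hu.const_mul (2 ^ ((n : ℝ) + α))).mono' ?_ (Eventually.of_forall fun x => ?_)
  · exact (hm.aemeasurable.div (by fun_prop)).aestronglyMeasurable
  · have h0 : 0 < 1 + ‖x‖ := by positivity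
    have h1 : 0 < 1 + ‖x‖ ^ ((n : ℝ) + α) := by positivity
    rw [norm_div, Real.norm_of_nonneg h1.le, Real.rpow_neg h0.le, div_eq_mul_inv, ← mul_assoc,
      mul_comm (2 ^ _), mul_assoc]
    gcongr
    rw [inv_eq_one_div, ← div_eq_mul_inv, div_le_div_iff₀ h1 (by positivity), one_mul]
    exact rpow_one_add_le hp (norm_nonneg x)

/-- A distributionally `α`-harmonic function annihilates the fractional Laplacian of every
Schwartz function. -/
theorem AlphaHarmonic.integral_mul_secondDiffLap (hn : 1 ≤ n) (hα0 : 0 < α) (hα2 : α < 2)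
    {u : EuclideanSpace ℝ (Fin n) → ℝ} (hu : InLalpha n α u) (h : AlphaHarmonic n α u)
    (f : SchwartzMap (EuclideanSpace ℝ (Fin n)) ℝ) : ∫ x, u x * secondDiffLap n α f x = 0 := by
  obtain ⟨A, φ, hφ, hφc, hφd, hlim⟩ := f.exists_truncation
  have h0 : ∀ k, ∫ x, u x * secondDiffLap n α (φ k) x = 0 := by
    intro k
    have := h (φ k) (hφ k) (hφc k) _ fun x => (hφd k).isFracLapAt hn hα0 hα2 x
    simp only [← mul_div_assoc, integral_div] at this
    simpa using this
  set C := A * ∫ y, domFun n α (0 : EuclideanSpace ℝ (Fin n)) y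
  have hT : Tendsto (fun k => ∫ x, u x * secondDiffLap n α (φ k) x) atTop
      (𝓝 (∫ x, u x * secondDiffLap n α f x)) := by
    refine tendsto_integral_of_dominated_convergence
      (fun x => C * (‖u x‖ * (1 + ‖x‖) ^ (-((n : ℝ) + α)))) (fun k => ?_)
      ((hu.integrable_mul_japanese hα0).const_mul C)
      (fun k => Eventually.of_forall fun x => ?_) (Eventually.of_forall fun x => ?_)
    · exact (hu.aestronglyMeasurable hα0).mul
        (stronglyMeasurable_secondDiffLap (hφd k).cont).aestronglyMeasurable
    · rw [norm_mul]
      calc ‖u x‖ * ‖secondDiffLap n α (φ k) x‖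
          ≤ ‖u x‖ * (C * (1 + ‖x‖) ^ (-((n : ℝ) + α))) := by
            gcongr; exact (hφd k).norm_secondDiffLap_le hn hα0 hα2 x
        _ = _ := by ring
    · exact (tendsto_secondDiffLap hn hα0 hα2 hφd hlim x).const_mul _
  simp only [h0] at hT
  exact (tendsto_nhds_unique hT tendsto_const_nhds)

end Pairing

section Symbol

variable {n : ℕ} {α : ℝ}

/-- The symbol `∫ (2 - 2 cos(2π⟨ξ, y⟩)) / |y|^{n+α} dy` of the (unnormalized) operator
`secondDiffLap`. -/
def lapSymbol (n : ℕ) (α : ℝ) (ξ : EuclideanSpace ℝ (Fin n)) : ℝ :=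
  ∫ y, ‖y‖ ^ (-((n : ℝ) + α)) * (2 - 2 * Real.cos (2 * Real.pi * inner ℝ ξ y))

theorem two_sub_two_mul_cos_nonneg (t : ℝ) : 0 ≤ 2 - 2 * Real.cos t := by
  linarith [Real.cos_le_one t]

theorem two_sub_two_mul_cos_le (t : ℝ) : 2 - 2 * Real.cos t ≤ t ^ 2 := by
  linarith [Real.one_sub_sq_div_two_le_cos (x := t)]

theorem lapSymbol_integrand_le (hα0 : 0 < α) (ξ y : EuclideanSpace ℝ (Fin n)) :
    ‖y‖ ^ (-((n : ℝ) + α)) * (2 - 2 * Real.cos (2 * Real.pi * inner ℝ ξ y)) ≤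
      (4 + (2 * Real.pi * ‖ξ‖) ^ 2) * domFun n α 0 y := by
  have hpos : 0 ≤ (2 : ℝ) ^ ((n : ℝ) + α) * ((1 + ‖y‖) ^ (-((n : ℝ) + α)) +
      (1 + ‖y‖) ^ (-((n : ℝ) + α)) + (1 + ‖0 + y‖) ^ (-((n : ℝ) + 2 - α)) +
        (1 + ‖0 - y‖) ^ (-((n : ℝ) + 2 - α))) := by positivity
  by_cases hy : ‖y‖ ≤ 1
  · have h1 : 2 - 2 * Real.cos (2 * Real.pi * inner ℝ ξ y) ≤ (2 * Real.pi * ‖ξ‖) ^ 2 * ‖y‖ ^ 2 := by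
      refine (two_sub_two_mul_cos_le _).trans ?_
      rw [← mul_pow, ← sq_abs]
      refine pow_le_pow_left₀ (abs_nonneg _) ?_ 2
      rw [abs_mul, abs_of_pos (by positivity), mul_assoc (2 * Real.pi)]
      gcongr
      exact abs_real_inner_le_norm _ _
    have h2 : ‖y‖ ^ 2 * ‖y‖ ^ (-((n : ℝ) + α)) ≤ domFun n α 0 y := by
      unfold domFun
      rw [Set.indicator_of_mem (by simpa using hy)]
      linarith
    calc ‖y‖ ^ (-((n : ℝ) + α)) * (2 - 2 * Real.cos (2 * Real.pi * inner ℝ ξ y))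
        ≤ ‖y‖ ^ (-((n : ℝ) + α)) * ((2 * Real.pi * ‖ξ‖) ^ 2 * ‖y‖ ^ 2) := by gcongr
      _ = (2 * Real.pi * ‖ξ‖) ^ 2 * (‖y‖ ^ 2 * ‖y‖ ^ (-((n : ℝ) + α))) := by ring
      _ ≤ (2 * Real.pi * ‖ξ‖) ^ 2 * domFun n α 0 y := by gcongr
      _ ≤ _ := by
        have := domFun_nonneg (n := n) (α := α) 0 y
        linarith
  · have h1 : 2 - 2 * Real.cos (2 * Real.pi * inner ℝ ξ y) ≤ 4 := by
      linarith [Real.neg_one_le_cos (2 * Real.pi * inner ℝ ξ y)]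
    have h2 : ‖y‖ ^ (-((n : ℝ) + α)) ≤ domFun n α 0 y := by
      refine (norm_rpow_neg_le_of_one_lt (by positivity) (not_le.1 hy)).trans ?_
      unfold domFun
      rw [Set.indicator_of_notMem (by simpa using hy), zero_add]
      gcongr
      have : 0 ≤ (1 + ‖y‖) ^ (-((n : ℝ) + α)) := by positivity
      have : 0 ≤ (1 + ‖0 + y‖) ^ (-((n : ℝ) + 2 - α)) := by positivity
      have : 0 ≤ (1 + ‖0 - y‖) ^ (-((n : ℝ) + 2 - α)) := by positivity
      linarith
    have h3 := domFun_nonneg (n := n) (α := α) 0 y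
    calc ‖y‖ ^ (-((n : ℝ) + α)) * (2 - 2 * Real.cos (2 * Real.pi * inner ℝ ξ y))
        ≤ domFun n α 0 y * 4 := by
          gcongr
          exact two_sub_two_mul_cos_nonneg _
      _ ≤ _ := by nlinarith [sq_nonneg (2 * Real.pi * ‖ξ‖)]

theorem lapSymbol_integrand_nonneg (ξ y : EuclideanSpace ℝ (Fin n)) :
    0 ≤ ‖y‖ ^ (-((n : ℝ) + α)) * (2 - 2 * Real.cos (2 * Real.pi * inner ℝ ξ y)) :=
  mul_nonneg (by positivity) (two_sub_two_mul_cos_nonneg _)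

theorem measurable_lapSymbol_integrand :
    Measurable fun p : EuclideanSpace ℝ (Fin n) × EuclideanSpace ℝ (Fin n) =>
      ‖p.2‖ ^ (-((n : ℝ) + α)) * (2 - 2 * Real.cos (2 * Real.pi * inner ℝ p.1 p.2)) := by
  refine (measurable_snd.norm.pow_const _).mul (Continuous.measurable ?_)
  fun_prop

theorem integrable_lapSymbol (hn : 1 ≤ n) (hα0 : 0 < α) (hα2 : α < 2)
    (ξ : EuclideanSpace ℝ (Fin n)) :
    Integrable fun y => ‖y‖ ^ (-((n : ℝ) + α)) * (2 - 2 * Real.cos (2 * Real.pi * inner ℝ ξ y)) := by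
  refine ((integrable_domFun hn hα0 hα2 0).const_mul (4 + (2 * Real.pi * ‖ξ‖) ^ 2)).mono'
    (measurable_lapSymbol_integrand.comp measurable_prodMk_left).aestronglyMeasurable
    (Eventually.of_forall fun y => ?_)
  rw [Real.norm_of_nonneg (lapSymbol_integrand_nonneg ξ y)]
  exact lapSymbol_integrand_le hα0 ξ y

theorem lapSymbol_pos (hn : 1 ≤ n) (hα0 : 0 < α) (hα2 : α < 2)
    {ξ : EuclideanSpace ℝ (Fin n)} (hξ : ξ ≠ 0) : 0 < lapSymbol n α ξ := by
  unfold lapSymbol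
  rw [integral_pos_iff_support_of_nonneg (lapSymbol_integrand_nonneg ξ)
    (integrable_lapSymbol hn hα0 hα2 ξ)]
  have hopen : IsOpen {y : EuclideanSpace ℝ (Fin n) |
      0 < ‖y‖ ∧ Real.cos (2 * Real.pi * inner ℝ ξ y) < 1} :=
    (isOpen_lt continuous_const continuous_norm).inter
      (isOpen_lt (f := fun y => Real.cos (2 * Real.pi * inner ℝ ξ y)) (by fun_prop)
        continuous_const)
  have hξ' : 0 < ‖ξ‖ := norm_pos_iff.2 hξ
  refine (hopen.measure_pos volume ⟨(1 / (2 * ‖ξ‖ ^ 2)) • ξ, ?_, ?_⟩).trans_le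
    (measure_mono fun y hy => ?_)
  · rw [norm_smul, Real.norm_of_nonneg (by positivity)]
    positivity
  · rw [inner_smul_right, real_inner_self_eq_norm_sq,
      show 2 * Real.pi * (1 / (2 * ‖ξ‖ ^ 2) * ‖ξ‖ ^ 2) = Real.pi by field_simp, Real.cos_pi]
    norm_num
  · have h1 : 0 < ‖y‖ ^ (-((n : ℝ) + α)) := Real.rpow_pos_of_pos hy.1 _
    have h2 : 0 < 2 - 2 * Real.cos (2 * Real.pi * inner ℝ ξ y) := by linarith [hy.2]
    exact (mul_pos h1 h2).ne'

theorem lapSymbol_smul (ξ : EuclideanSpace ℝ (Fin n)) {t : ℝ} (ht : 0 < t) :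
    lapSymbol n α (t • ξ) = t ^ α * lapSymbol n α ξ := by
  have h := Measure.integral_comp_smul_of_nonneg (volume : Measure (EuclideanSpace ℝ (Fin n)))
    (fun y => ‖y‖ ^ (-((n : ℝ) + α)) * (2 - 2 * Real.cos (2 * Real.pi * inner ℝ ξ y))) t
    (hR := ht.le)
  have h2 : ∀ y : EuclideanSpace ℝ (Fin n),
      ‖t • y‖ ^ (-((n : ℝ) + α)) * (2 - 2 * Real.cos (2 * Real.pi * inner ℝ ξ (t • y))) =
      t ^ (-((n : ℝ) + α)) *
        (‖y‖ ^ (-((n : ℝ) + α)) * (2 - 2 * Real.cos (2 * Real.pi * inner ℝ (t • ξ) y))) := by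
    intro y
    rw [norm_smul, Real.norm_of_nonneg ht.le, Real.mul_rpow ht.le (norm_nonneg y),
      inner_smul_right, real_inner_smul_left, mul_assoc]
  simp only [h2, integral_const_mul, finrank_euclideanSpace_fin, smul_eq_mul] at h
  unfold lapSymbol
  rw [neg_add, Real.rpow_add ht, Real.rpow_neg ht.le, Real.rpow_natCast, Real.rpow_neg ht.le,
    mul_assoc] at h
  have h3 := mul_left_cancel₀ (inv_ne_zero (pow_ne_zero n ht.ne')) h
  rw [neg_add, ← h3, mul_inv_cancel_left₀ (Real.rpow_pos_of_pos ht α).ne']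

theorem lapSymbol_eq_of_norm_eq {ξ η : EuclideanSpace ℝ (Fin n)} (h : ‖ξ‖ = ‖η‖) :
    lapSymbol n α ξ = lapSymbol n α η := by
  obtain ⟨L, hL⟩ : ∃ L : EuclideanSpace ℝ (Fin n) ≃ₗᵢ[ℝ] EuclideanSpace ℝ (Fin n), L ξ = η :=
    ⟨_, Submodule.reflection_sub h⟩
  unfold lapSymbol
  rw [← L.measurePreserving.integral_comp L.toMeasurableEquiv.measurableEmbedding
    (fun y => ‖y‖ ^ (-((n : ℝ) + α)) * (2 - 2 * Real.cos (2 * Real.pi * inner ℝ η y)))]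
  simp only [← hL, L.norm_map, L.inner_map_map]

theorem lapSymbol_eq {ξ e : EuclideanSpace ℝ (Fin n)} (he : ‖e‖ = 1) (hξ : ξ ≠ 0) :
    lapSymbol n α ξ = ‖ξ‖ ^ α * lapSymbol n α e := by
  rw [← lapSymbol_smul e (norm_pos_iff.2 hξ)]
  exact lapSymbol_eq_of_norm_eq (by rw [norm_smul, he, norm_norm, mul_one])

/-- The real cosine transform. -/
def cosTransform {n : ℕ} (ψ : EuclideanSpace ℝ (Fin n) → ℝ) (x : EuclideanSpace ℝ (Fin n)) : ℝ :=
  ∫ ξ, Real.cos (2 * Real.pi * inner ℝ ξ x) * ψ ξ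

theorem exists_schwartz_cosTransform {ψ : EuclideanSpace ℝ (Fin n) → ℝ}
    (hψ : ContDiff ℝ (⊤ : ℕ∞) ψ) (hc : HasCompactSupport ψ) :
    ∃ f : SchwartzMap (EuclideanSpace ℝ (Fin n)) ℝ, (∀ x, f x = cosTransform ψ x) ∧
      ∫ x, f x = ψ 0 := by
  have hc' : HasCompactSupport fun ξ => (ψ ξ : ℂ) := hc.comp_left (g := ((↑) : ℝ → ℂ)) rfl
  have hψ' : ContDiff ℝ (⊤ : ℕ∞) fun ξ => (ψ ξ : ℂ) := Complex.ofRealCLM.contDiff.comp hψ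
  let Ψ : SchwartzMap (EuclideanSpace ℝ (Fin n)) ℂ := hc'.toSchwartzMap hψ'
  have hΨ : ∀ ξ, Ψ ξ = (ψ ξ : ℂ) := fun ξ => rfl
  refine ⟨SchwartzMap.postcompCLM Complex.reCLM (FourierTransformInv.fourierInv Ψ),
    fun x => ?_, ?_⟩
  · have hint : Integrable fun ξ : EuclideanSpace ℝ (Fin n) =>
        Complex.exp (↑(2 * Real.pi * inner ℝ ξ x) * Complex.I) • Ψ ξ := by
      refine Ψ.integrable.norm.mono' ?_ (Eventually.of_forall fun ξ => ?_)
      · exact Continuous.aestronglyMeasurable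
          ((by fun_prop : Continuous fun ξ : EuclideanSpace ℝ (Fin n) =>
            Complex.exp (↑(2 * Real.pi * inner ℝ ξ x) * Complex.I)).smul Ψ.continuous)
      · rw [norm_smul, Complex.norm_exp_ofReal_mul_I, one_mul]
    rw [SchwartzMap.postcompCLM_apply, SchwartzMap.fourierInv_coe, Real.fourierInv_eq',
      ← Complex.reCLM.integral_comp_comm hint]
    refine integral_congr_ae (Eventually.of_forall fun ξ => ?_)
    simp only [hΨ, smul_eq_mul, Complex.reCLM_apply, Complex.re_mul_ofReal,
      Complex.exp_ofReal_mul_I_re]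
  · have h0 : ∫ x, (FourierTransformInv.fourierInv Ψ) x = Ψ 0 := by
      have h1 : FourierTransform.fourier (FourierTransformInv.fourierInv Ψ) = Ψ :=
        FourierTransform.fourier_fourierInv_eq Ψ
      have h2 := congrArg (fun F : SchwartzMap (EuclideanSpace ℝ (Fin n)) ℂ => F 0) h1
      simp only [SchwartzMap.fourier_coe] at h2
      rw [← h2, Real.fourier_eq']
      simp
    have h3 : ∫ x, Complex.reCLM ((FourierTransformInv.fourierInv Ψ) x) =
        Complex.reCLM (∫ x, (FourierTransformInv.fourierInv Ψ) x) :=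
      Complex.reCLM.integral_comp_comm (SchwartzMap.integrable _)
    rw [h0, hΨ, Complex.reCLM_apply, Complex.ofReal_re] at h3
    exact h3

theorem secondDiff_cos (ξ x y : EuclideanSpace ℝ (Fin n)) :
    secondDiff (fun x => Real.cos (2 * Real.pi * inner ℝ ξ x)) x y =
      Real.cos (2 * Real.pi * inner ℝ ξ x) * (2 - 2 * Real.cos (2 * Real.pi * inner ℝ ξ y)) := by
  simp only [secondDiff, inner_add_right, inner_sub_right, mul_add, mul_sub, Real.cos_add,
    Real.cos_sub]
  ring

theorem integrable_cos_mul {ψ : EuclideanSpace ℝ (Fin n) → ℝ} (hψ : Integrable ψ)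
    (x : EuclideanSpace ℝ (Fin n)) :
    Integrable fun ξ => Real.cos (2 * Real.pi * inner ℝ ξ x) * ψ ξ :=
  hψ.bdd_mul (c := 1) (by fun_prop) (Eventually.of_forall fun ξ => by
    simpa using Real.abs_cos_le_one _)

theorem secondDiff_cosTransform {ψ : EuclideanSpace ℝ (Fin n) → ℝ} (hψ : Integrable ψ)
    (x y : EuclideanSpace ℝ (Fin n)) :
    secondDiff (cosTransform ψ) x y = ∫ ξ, Real.cos (2 * Real.pi * inner ℝ ξ x) *
      (2 - 2 * Real.cos (2 * Real.pi * inner ℝ ξ y)) * ψ ξ := by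
  unfold secondDiff cosTransform
  have i := integrable_cos_mul hψ
  have e1 := integral_add (i x) (i x)
  have e2 := integral_sub ((i x).add (i x)) (i (x + y))
  have e3 := integral_sub (((i x).add (i x)).sub (i (x + y))) (i (x - y))
  simp only [Pi.add_apply, Pi.sub_apply] at e1 e2 e3
  rw [← e1, ← e2, ← e3]
  refine integral_congr_ae (Eventually.of_forall fun ξ => ?_)
  simp only
  rw [← secondDiff_cos]
  simp only [secondDiff]
  ring

theorem secondDiffLap_cosTransform (hn : 1 ≤ n) (hα0 : 0 < α) (hα2 : α < 2)
    {ψ : EuclideanSpace ℝ (Fin n) → ℝ} (hψ : Continuous ψ) (hc : HasCompactSupport ψ)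
    (x : EuclideanSpace ℝ (Fin n)) :
    secondDiffLap n α (cosTransform ψ) x = cosTransform (fun ξ => lapSymbol n α ξ * ψ ξ) x := by
  have hi : Integrable ψ := hψ.integrable_of_hasCompactSupport hc
  have hi2 : Integrable fun ξ => ‖ψ ξ‖ * (4 + (2 * Real.pi * ‖ξ‖) ^ 2) :=
    Continuous.integrable_of_hasCompactSupport (by fun_prop) hc.norm.mul_right
  have hprod : Integrable (Function.uncurry fun y ξ : EuclideanSpace ℝ (Fin n) =>
      ‖y‖ ^ (-((n : ℝ) + α)) * (Real.cos (2 * Real.pi * inner ℝ ξ x) *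
        (2 - 2 * Real.cos (2 * Real.pi * inner ℝ ξ y)) * ψ ξ))
      ((volume : Measure (EuclideanSpace ℝ (Fin n))).prod volume) := by
    refine ((integrable_domFun hn hα0 hα2 0).mul_prod hi2).mono' ?_
      (Eventually.of_forall fun p => ?_)
    · refine Measurable.aestronglyMeasurable ?_
      refine (measurable_fst.norm.pow_const _).mul (Continuous.measurable ?_)
      fun_prop
    · obtain ⟨y, ξ⟩ := p
      have h1 := lapSymbol_integrand_le hα0 ξ y
      have h2 := Real.abs_cos_le_one (2 * Real.pi * inner ℝ ξ x)
      have h3 := lapSymbol_integrand_nonneg (α := α) ξ y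
      simp only [Function.uncurry_apply_pair]
      calc ‖‖y‖ ^ (-((n : ℝ) + α)) * (Real.cos (2 * Real.pi * inner ℝ ξ x) *
            (2 - 2 * Real.cos (2 * Real.pi * inner ℝ ξ y)) * ψ ξ)‖
          = |Real.cos (2 * Real.pi * inner ℝ ξ x)| * ((‖y‖ ^ (-((n : ℝ) + α)) *
            (2 - 2 * Real.cos (2 * Real.pi * inner ℝ ξ y))) * ‖ψ ξ‖) := by
            rw [← abs_of_nonneg h3]
            simp only [norm_mul, Real.norm_eq_abs, abs_mul]
            ring
        _ ≤ 1 * (((4 + (2 * Real.pi * ‖ξ‖) ^ 2) * domFun n α 0 y) * ‖ψ ξ‖) := by gcongr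
        _ = _ := by ring
  unfold secondDiffLap
  simp only [secondDiff_cosTransform hi, smul_eq_mul, ← integral_const_mul]
  rw [integral_integral_swap hprod]
  unfold cosTransform
  refine integral_congr_ae (Eventually.of_forall fun ξ => ?_)
  simp only [lapSymbol]
  rw [← integral_mul_const, ← integral_const_mul]
  refine integral_congr_ae (Eventually.of_forall fun y => ?_)
  simp only
  ring

/-- Every cosine transform of a test function vanishing near the frequency origin is the
fractional Laplacian of a Schwartz function. -/
theorem exists_schwartz_secondDiffLap_eq (hn : 1 ≤ n) (hα0 : 0 < α) (hα2 : α < 2)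
    {ψ : EuclideanSpace ℝ (Fin n) → ℝ} (hψ : ContDiff ℝ (⊤ : ℕ∞) ψ) (hc : HasCompactSupport ψ)
    (h0 : ∀ᶠ ξ in 𝓝 0, ψ ξ = 0) :
    ∃ f : SchwartzMap (EuclideanSpace ℝ (Fin n)) ℝ,
      ∀ x, secondDiffLap n α f x = cosTransform ψ x := by
  obtain ⟨e, he⟩ : ∃ e : EuclideanSpace ℝ (Fin n), ‖e‖ = 1 :=
    ⟨EuclideanSpace.single ⟨0, hn⟩ 1, by simp⟩
  have hM : 0 < lapSymbol n α e := lapSymbol_pos hn hα0 hα2 (norm_pos_iff.1 (by simp [he]))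
  let η : EuclideanSpace ℝ (Fin n) → ℝ := fun ξ => (‖ξ‖ ^ α * lapSymbol n α e)⁻¹ * ψ ξ
  have hη : ContDiff ℝ (⊤ : ℕ∞) η := by
    rw [contDiff_iff_contDiffAt]
    intro ξ
    by_cases hξ : ξ = 0
    · subst hξ
      refine (contDiffAt_const (c := (0 : ℝ))).congr_of_eventuallyEq (h0.mono fun ξ hξ => ?_)
      simp [η, hξ]
    · refine ContDiffAt.mul (ContDiffAt.inv ?_ ?_) hψ.contDiffAt
      · exact ((contDiffAt_norm ℝ hξ).rpow_const_of_ne (norm_ne_zero_iff.2 hξ)).mul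
          contDiffAt_const
      · have : 0 < ‖ξ‖ := norm_pos_iff.2 hξ
        positivity
  have hηc : HasCompactSupport η := hc.mul_left
  obtain ⟨f, hf, -⟩ := exists_schwartz_cosTransform hη hηc
  refine ⟨f, fun x => ?_⟩
  rw [show (f : EuclideanSpace ℝ (Fin n) → ℝ) = cosTransform η from funext hf,
    secondDiffLap_cosTransform hn hα0 hα2 hη.continuous hηc]
  congr 1
  funext ξ
  by_cases hξ : ξ = 0
  · subst hξ
    simp [η, h0.self_of_nhds]
  · have : 0 < ‖ξ‖ := norm_pos_iff.2 hξ
    have h1 : ‖ξ‖ ^ α * lapSymbol n α e ≠ 0 := by positivity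
    simp only [η]
    rw [lapSymbol_eq he hξ, mul_inv_cancel_left₀ h1]

theorem cosTransform_comp_smul (ψ : EuclideanSpace ℝ (Fin n) → ℝ) {R : ℝ} (hR : 0 < R)
    (x : EuclideanSpace ℝ (Fin n)) :
    cosTransform (fun ξ => ψ (R • ξ)) x = (R ^ n)⁻¹ * cosTransform ψ (R⁻¹ • x) := by
  have h := Measure.integral_comp_smul_of_nonneg (volume : Measure (EuclideanSpace ℝ (Fin n)))
    (fun ξ => Real.cos (2 * Real.pi * inner ℝ ξ (R⁻¹ • x)) * ψ ξ) R (hR := hR.le)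
  simp only [finrank_euclideanSpace_fin, smul_eq_mul, real_inner_smul_left,
    inner_smul_right, inv_mul_cancel_left₀ hR.ne'] at h
  unfold cosTransform
  simpa only [inner_smul_right] using h

theorem secondDiffLap_comp_sub (f : EuclideanSpace ℝ (Fin n) → ℝ)
    (a x : EuclideanSpace ℝ (Fin n)) :
    secondDiffLap n α (fun x => f (x - a)) x = secondDiffLap n α f (x - a) := by
  unfold secondDiffLap secondDiff
  simp only [add_sub_right_comm, sub_right_comm]

theorem AlphaHarmonic.integral_mul_cosTransform (hn : 1 ≤ n) (hα0 : 0 < α) (hα2 : α < 2)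
    {u : EuclideanSpace ℝ (Fin n) → ℝ} (hu : InLalpha n α u) (h : AlphaHarmonic n α u)
    {ψ : EuclideanSpace ℝ (Fin n) → ℝ} (hψ : ContDiff ℝ (⊤ : ℕ∞) ψ) (hc : HasCompactSupport ψ)
    (h0 : ∀ᶠ ξ in 𝓝 0, ψ ξ = 0) (x : EuclideanSpace ℝ (Fin n)) :
    ∫ z, u z * cosTransform ψ (z - x) = 0 := by
  obtain ⟨f, hf⟩ := exists_schwartz_secondDiffLap_eq hn hα0 hα2 hψ hc h0
  have := h.integral_mul_secondDiffLap hn hα0 hα2 hu (f.compSubConstCLM ℝ x)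
  have h1 : (f.compSubConstCLM ℝ x : EuclideanSpace ℝ (Fin n) → ℝ) = fun z => f (z - x) := by
    funext z
    exact SchwartzMap.compSubConstCLM_apply ..
  simpa only [h1, secondDiffLap_comp_sub, hf] using this

theorem one_add_norm_smul_sub_rpow_le {p t : ℝ} (hp : 0 ≤ p) (ht : 0 < t)
    (x z : EuclideanSpace ℝ (Fin n)) :
    (1 + ‖t • (z - x)‖) ^ (-p) ≤ ((1 + ‖x‖) * (1 + t⁻¹)) ^ p * (1 + ‖z‖) ^ (-p) := by
  have h1 : 1 + ‖z‖ ≤ (1 + ‖x‖) * (1 + t⁻¹) * (1 + ‖t • (z - x)‖) := by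
    have h2 : 1 + ‖z - x‖ ≤ (1 + t⁻¹) * (1 + ‖t • (z - x)‖) := by
      rw [norm_smul, Real.norm_of_nonneg ht.le]
      have h3 : (1 + t⁻¹) * (1 + t * ‖z - x‖) = 1 + t⁻¹ + t * ‖z - x‖ + ‖z - x‖ := by
        field_simp
        ring
      have h4 : 0 ≤ t⁻¹ + t * ‖z - x‖ := by positivity
      linarith
    rw [mul_assoc]
    exact (one_add_norm_le_mul z x).trans (by gcongr)
  rw [Real.rpow_neg (by positivity), Real.rpow_neg (by positivity), ← div_eq_mul_inv,
    inv_eq_one_div, div_le_div_iff₀ (by positivity) (by positivity), one_mul,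
    ← Real.mul_rpow (by positivity) (by positivity)]
  exact Real.rpow_le_rpow (by positivity) h1 hp

theorem SchwartzMap.exists_norm_le (hα2 : α < 2) (f : SchwartzMap (EuclideanSpace ℝ (Fin n)) ℝ) :
    ∃ A : ℝ, 0 ≤ A ∧ ∀ x, ‖f x‖ ≤ A * (1 + ‖x‖) ^ (-((n : ℝ) + α)) := by
  obtain ⟨A, hA0, hA⟩ := f.exists_iteratedFDeriv_le
  refine ⟨A, hA0, fun x => ?_⟩
  have h := hA 0 (by norm_num) x
  rw [norm_iteratedFDeriv_zero] at h
  refine h.trans ?_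
  have hn : (0 : ℝ) ≤ n := by positivity
  gcongr
  · linarith [norm_nonneg x]
  · linarith

theorem InLalpha.integrable_mul_schwartz_comp {u : EuclideanSpace ℝ (Fin n) → ℝ} (hα0 : 0 < α)
    (hα2 : α < 2) (hu : InLalpha n α u) (χ : SchwartzMap (EuclideanSpace ℝ (Fin n)) ℝ)
    {t : ℝ} (ht : 0 < t) (x : EuclideanSpace ℝ (Fin n)) :
    Integrable fun z => u z * χ (t • (z - x)) := by
  obtain ⟨A, hA0, hA⟩ := χ.exists_norm_le hα2
  have hc : Continuous fun z => χ (t • (z - x)) := χ.continuous.comp (by fun_prop)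
  refine hu.integrable_mul hα0 hc.aestronglyMeasurable
    (C := A * ((1 + ‖x‖) * (1 + t⁻¹)) ^ ((n : ℝ) + α)) fun z => (hA _).trans ?_
  rw [mul_assoc]
  gcongr
  exact one_add_norm_smul_sub_rpow_le (by positivity) ht x z

/-- A Schwartz mollifier `χ` such that pairing a distributionally `α`-harmonic function with the
rescalings of `χ` gives a result independent of the scale. -/
theorem exists_scale_invariant_mollifier (hn : 1 ≤ n) (hα0 : 0 < α) (hα2 : α < 2) :
    ∃ χ : SchwartzMap (EuclideanSpace ℝ (Fin n)) ℝ, ∫ x, χ x = 1 ∧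
      ∀ u : EuclideanSpace ℝ (Fin n) → ℝ, InLalpha n α u → AlphaHarmonic n α u →
        ∀ R : ℝ, 0 < R → ∀ x,
          ∫ z, u z * ((R ^ n)⁻¹ * χ (R⁻¹ • (z - x))) = ∫ z, u z * χ (z - x) := by
  let g : ContDiffBump (0 : EuclideanSpace ℝ (Fin n)) := ⟨1, 2, one_pos, one_lt_two⟩
  obtain ⟨χ, hχ, hχ1⟩ := exists_schwartz_cosTransform (ψ := g) g.contDiff g.hasCompactSupport
  have hg0 : g 0 = 1 := g.one_of_mem_closedBall (mem_closedBall_self zero_le_one)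
  refine ⟨χ, by rw [hχ1, hg0], fun u hu h R hR x => ?_⟩
  have hgR : ContDiff ℝ (⊤ : ℕ∞) fun ξ : EuclideanSpace ℝ (Fin n) => g (R • ξ) :=
    g.contDiff.comp (contDiff_const_smul _)
  have hgRc : HasCompactSupport fun ξ : EuclideanSpace ℝ (Fin n) => g (R • ξ) :=
    g.hasCompactSupport.comp_smul hR.ne'
  have hev : ∀ᶠ ξ : EuclideanSpace ℝ (Fin n) in 𝓝 0, g ξ = 1 := g.eventuallyEq_one
  have hevR : ∀ᶠ ξ : EuclideanSpace ℝ (Fin n) in 𝓝 0, g (R • ξ) = 1 := by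
    have ht : Tendsto (fun ξ : EuclideanSpace ℝ (Fin n) => R • ξ) (𝓝 0) (𝓝 0) := by
      simpa using (continuous_const_smul R).tendsto (0 : EuclideanSpace ℝ (Fin n))
    exact ht.eventually hev
  have key := h.integral_mul_cosTransform hn hα0 hα2 hu (hgR.sub g.contDiff)
    (hgRc.sub g.hasCompactSupport) ((hev.and hevR).mono fun ξ hξ => by simp [hξ.1, hξ.2]) x
  have hsub : ∀ z, cosTransform (fun ξ => g (R • ξ) - g ξ) z =
      (R ^ n)⁻¹ * χ (R⁻¹ • z) - χ z := by
    intro z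
    rw [hχ, hχ, ← cosTransform_comp_smul _ hR]
    unfold cosTransform
    rw [← integral_sub
      (integrable_cos_mul (hgR.continuous.integrable_of_hasCompactSupport hgRc) z)
      (integrable_cos_mul (g.continuous.integrable_of_hasCompactSupport g.hasCompactSupport) z)]
    simp only [mul_sub]
  have i1 : Integrable fun z => u z * ((R ^ n)⁻¹ * χ (R⁻¹ • (z - x))) := by
    refine ((hu.integrable_mul_schwartz_comp hα0 hα2 χ (inv_pos.2 hR) x).const_mul
      (R ^ n)⁻¹).congr (Eventually.of_forall fun z => ?_)
    simp only
    ring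
  have i2 : Integrable fun z => u z * χ (z - x) := by
    simpa using hu.integrable_mul_schwartz_comp hα0 hα2 χ one_pos x
  simp only [hsub, mul_sub (u _)] at key
  rw [integral_sub i1 i2] at key
  exact sub_eq_zero.1 key

end Symbol

section Liouville

variable {n : ℕ} {α : ℝ}

theorem InLalpha.locallyIntegrable {u : EuclideanSpace ℝ (Fin n) → ℝ} (hα0 : 0 < α)
    (hu : InLalpha n α u) : LocallyIntegrable u := by
  have h1 : Continuous fun x : EuclideanSpace ℝ (Fin n) => 1 + ‖x‖ ^ ((n : ℝ) + α) :=
    continuous_const.add (continuous_norm.rpow_const fun x => Or.inr (by positivity))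
  rw [locallyIntegrable_iff]
  intro K hK
  refine (IntegrableOn.continuousOn_mul h1.continuousOn (Integrable.integrableOn hu) hK).congr
    (Eventually.of_forall fun x => ?_)
  simp only
  exact mul_div_cancel₀ _ (by positivity)

theorem continuous_integral_mul_translate (hα0 : 0 < α) (hα2 : α < 2)
    {u : EuclideanSpace ℝ (Fin n) → ℝ} (hu : InLalpha n α u)
    (χ : SchwartzMap (EuclideanSpace ℝ (Fin n)) ℝ) :
    Continuous fun x => ∫ z, u z * χ (z - x) := by
  obtain ⟨A, hA0, hA⟩ := χ.exists_norm_le hα2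
  have hp : (0 : ℝ) ≤ n + α := by positivity
  refine continuous_iff_continuousAt.2 fun x₀ => ?_
  refine continuousAt_of_dominated (bound := fun z => A * ((2 + ‖x₀‖) * 2) ^ ((n : ℝ) + α) *
    (‖u z‖ * (1 + ‖z‖) ^ (-((n : ℝ) + α)))) (Eventually.of_forall fun x => ?_) ?_
    ((hu.integrable_mul_japanese hα0).const_mul _) (Eventually.of_forall fun z => ?_)
  · simpa using (hu.integrable_mul_schwartz_comp hα0 hα2 χ one_pos x).aestronglyMeasurable
  · filter_upwards [ball_mem_nhds x₀ one_pos] with x hx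
    have hx' : ‖x‖ ≤ 1 + ‖x₀‖ := by
      have h1 := norm_sub_norm_le x x₀
      rw [mem_ball_iff_norm] at hx
      linarith
    refine Eventually.of_forall fun z => ?_
    have h2 := one_add_norm_smul_sub_rpow_le hp one_pos x z
    rw [one_smul, inv_one, one_add_one_eq_two] at h2
    rw [norm_mul]
    calc ‖u z‖ * ‖χ (z - x)‖
        ≤ ‖u z‖ * (A * (((1 + ‖x‖) * 2) ^ ((n : ℝ) + α) * (1 + ‖z‖) ^ (-((n : ℝ) + α)))) := by
          gcongr
          exact (hA _).trans (by gcongr)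
      _ ≤ ‖u z‖ * (A * (((2 + ‖x₀‖) * 2) ^ ((n : ℝ) + α) * (1 + ‖z‖) ^ (-((n : ℝ) + α)))) := by
          gcongr ?_ * (?_ * (?_ ^ _ * _))
          linarith
      _ = _ := by ring
  · exact (continuous_const.mul (χ.continuous.comp (by fun_prop))).continuousAt

/-- Fubini for the pairing of `u` with a mollified test function. -/
theorem integral_mul_mollify_eq (hα0 : 0 < α) (hα2 : α < 2)
    {u : EuclideanSpace ℝ (Fin n) → ℝ} (hu : InLalpha n α u)
    (χ : SchwartzMap (EuclideanSpace ℝ (Fin n)) ℝ) {η : EuclideanSpace ℝ (Fin n) → ℝ}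
    (hη : Continuous η) (hc : HasCompactSupport η) {S : ℝ} (hS : 0 < S) :
    ∫ x, η x * ∫ z, u z * ((S ^ n)⁻¹ * χ (S⁻¹ • (z - x))) =
      ∫ z, u z * ∫ y, η (z - S • y) * χ y := by
  obtain ⟨A, hA0, hA⟩ := χ.exists_norm_le hα2
  have hp : (0 : ℝ) ≤ n + α := by positivity
  have hi : Integrable fun x => ‖η x‖ * ((1 + ‖x‖) * (1 + S⁻¹⁻¹)) ^ ((n : ℝ) + α) := by
    refine Continuous.integrable_of_hasCompactSupport (hη.norm.mul ?_) hc.norm.mul_right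
    exact Continuous.rpow_const (by fun_prop) fun x => Or.inr hp
  have hprod : Integrable (Function.uncurry fun x z : EuclideanSpace ℝ (Fin n) =>
      η x * (u z * ((S ^ n)⁻¹ * χ (S⁻¹ • (z - x)))))
      ((volume : Measure (EuclideanSpace ℝ (Fin n))).prod volume) := by
    refine ((hi.mul_prod (hu.integrable_mul_japanese hα0)).const_mul ((S ^ n)⁻¹ * A)).mono' ?_
      (Eventually.of_forall fun p => ?_)
    · refine AEStronglyMeasurable.mul (hη.comp continuous_fst).aestronglyMeasurable
        (AEStronglyMeasurable.mul (hu.aestronglyMeasurable hα0).comp_snd ?_)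
      exact (continuous_const.mul (χ.continuous.comp (by fun_prop))).aestronglyMeasurable
    · obtain ⟨x, z⟩ := p
      have h1 := one_add_norm_smul_sub_rpow_le hp (inv_pos.2 hS) x z
      simp only [Function.uncurry_apply_pair, norm_mul, norm_inv, norm_pow,
        Real.norm_of_nonneg hS.le]
      calc ‖η x‖ * (‖u z‖ * ((S ^ n)⁻¹ * ‖χ (S⁻¹ • (z - x))‖))
          ≤ ‖η x‖ * (‖u z‖ * ((S ^ n)⁻¹ * (A * (((1 + ‖x‖) * (1 + S⁻¹⁻¹)) ^ ((n : ℝ) + α) *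
            (1 + ‖z‖) ^ (-((n : ℝ) + α)))))) := by
            gcongr
            exact (hA _).trans (by gcongr)
        _ = _ := by ring
  simp only [← integral_const_mul]
  rw [integral_integral_swap hprod]
  refine integral_congr_ae (Eventually.of_forall fun z => ?_)
  simp only
  have h2 := Measure.integral_comp_smul_of_nonneg (volume : Measure (EuclideanSpace ℝ (Fin n)))
    (fun y => η (z - S • y) * χ y) S⁻¹ (hR := (inv_pos.2 hS).le)
  have h3 := integral_sub_left_eq_self
    (fun y => η (z - S • S⁻¹ • y) * χ (S⁻¹ • y)) (volume : Measure (EuclideanSpace ℝ (Fin n))) z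
  rw [← h3] at h2
  simp only [smul_inv_smul₀ hS.ne', sub_sub_cancel, finrank_euclideanSpace_fin, smul_eq_mul,
    inv_pow, inv_inv] at h2
  have h4 : ∫ y, η (z - S • y) * χ y = (S ^ n)⁻¹ * ∫ x, η x * χ (S⁻¹ • (z - x)) := by
    rw [h2, inv_mul_cancel_left₀ (by positivity)]
  rw [integral_const_mul, h4, ← integral_const_mul, ← integral_const_mul]
  refine integral_congr_ae (Eventually.of_forall fun x => ?_)
  simp only
  ring

theorem tendsto_integral_mul_mollify (hα0 : 0 < α) (hα2 : α < 2)
    {u : EuclideanSpace ℝ (Fin n) → ℝ} (hu : InLalpha n α u)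
    (χ : SchwartzMap (EuclideanSpace ℝ (Fin n)) ℝ) (hχ : ∫ x, χ x = 1)
    {η : EuclideanSpace ℝ (Fin n) → ℝ} (hη : ContDiff ℝ (⊤ : ℕ∞) η) (hc : HasCompactSupport η) :
    Tendsto (fun k : ℕ => ∫ z, u z * ∫ y, η (z - (1 / ((k : ℝ) + 1)) • y) * χ y) atTop
      (𝓝 (∫ z, u z * η z)) := by
  have hp : (0 : ℝ) ≤ n + α := by positivity
  obtain ⟨A, hA0, hA⟩ := χ.exists_iteratedFDeriv_le
  obtain ⟨B, hB0, hB⟩ := (hc.toSchwartzMap hη).exists_norm_le hα2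
  replace hB : ∀ x, ‖η x‖ ≤ B * (1 + ‖x‖) ^ (-((n : ℝ) + α)) := hB
  have ht0 : Tendsto (fun k : ℕ => 1 / ((k : ℝ) + 1)) atTop (𝓝 0) :=
    tendsto_one_div_add_atTop_nhds_zero_nat
  have hχi : Integrable fun y => (1 + ‖y‖) ^ ((n : ℝ) + α) * ‖χ y‖ := by
    refine ((integrable_japanese (n := n) (s := n + 2 - α) (by linarith)).const_mul A).mono'
      ?_ (Eventually.of_forall fun y => ?_)
    · exact (Continuous.mul (Continuous.rpow_const (by fun_prop) fun x => Or.inr hp)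
        χ.continuous.norm).aestronglyMeasurable
    · have h1 := hA 0 (by norm_num) y
      rw [norm_iteratedFDeriv_zero] at h1
      rw [norm_mul, norm_norm, Real.norm_of_nonneg (by positivity)]
      calc (1 + ‖y‖) ^ ((n : ℝ) + α) * ‖χ y‖
          ≤ (1 + ‖y‖) ^ ((n : ℝ) + α) * (A * (1 + ‖y‖) ^ (-(2 * (n : ℝ) + 2))) := by gcongr
        _ = A * ((1 + ‖y‖) ^ ((n : ℝ) + α) * (1 + ‖y‖) ^ (-(2 * (n : ℝ) + 2))) := by ring
        _ = _ := by
          rw [← Real.rpow_add (by positivity)]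
          congr 2
          ring
  have hb : ∀ (k : ℕ) z y, ‖η (z - (1 / ((k : ℝ) + 1)) • y) * χ y‖ ≤
      B * (1 + ‖z‖) ^ (-((n : ℝ) + α)) * ((1 + ‖y‖) ^ ((n : ℝ) + α) * ‖χ y‖) := by
    intro k z y
    have h1 := one_add_norm_rpow_neg_le hp z (z - (1 / ((k : ℝ) + 1)) • y)
    have h2 : ‖(1 / ((k : ℝ) + 1)) • y‖ ≤ ‖y‖ := by
      rw [norm_smul, Real.norm_of_nonneg (by positivity)]
      refine mul_le_of_le_one_left (norm_nonneg y) ((div_le_one (by positivity)).2 ?_)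
      have : (0 : ℝ) ≤ k := by positivity
      linarith
    rw [sub_sub_cancel] at h1
    rw [norm_mul]
    calc ‖η (z - (1 / ((k : ℝ) + 1)) • y)‖ * ‖χ y‖
        ≤ B * ((1 + ‖(1 / ((k : ℝ) + 1)) • y‖) ^ ((n : ℝ) + α) *
          (1 + ‖z‖) ^ (-((n : ℝ) + α))) * ‖χ y‖ := by
          gcongr
          exact (hB _).trans (by gcongr)
      _ ≤ B * ((1 + ‖y‖) ^ ((n : ℝ) + α) * (1 + ‖z‖) ^ (-((n : ℝ) + α))) * ‖χ y‖ := by gcongr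
      _ = _ := by ring
  have hη' := hη.continuous
  have hmeas : ∀ k : ℕ, Continuous (Function.uncurry fun z y : EuclideanSpace ℝ (Fin n) =>
      η (z - (1 / ((k : ℝ) + 1)) • y) * χ y) := fun k =>
    (hη'.comp (by fun_prop)).mul (χ.continuous.comp continuous_snd)
  refine tendsto_integral_of_dominated_convergence
    (fun z => B * (∫ y, (1 + ‖y‖) ^ ((n : ℝ) + α) * ‖χ y‖) *
      (‖u z‖ * (1 + ‖z‖) ^ (-((n : ℝ) + α))))
    (fun k => (hu.aestronglyMeasurable hα0).mul
      ((hmeas k).stronglyMeasurable.integral_prod_right (ν := volume)).aestronglyMeasurable)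
    ((hu.integrable_mul_japanese hα0).const_mul _)
    (fun k => Eventually.of_forall fun z => ?_) (Eventually.of_forall fun z => ?_)
  · have h1 := norm_integral_le_of_norm_le (hχi.const_mul (B * (1 + ‖z‖) ^ (-((n : ℝ) + α))))
      (Eventually.of_forall (hb k z))
    rw [integral_const_mul] at h1
    rw [norm_mul]
    refine (mul_le_mul_of_nonneg_left h1 (norm_nonneg (u z))).trans_eq ?_
    ring
  · refine Tendsto.const_mul _ ?_
    have h0 : ∫ y, η z * χ y = η z := by rw [integral_const_mul, hχ, mul_one]
    rw [← h0]
    refine tendsto_integral_of_dominated_convergence _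
      (fun k => ((hmeas k).comp (Continuous.prodMk_right z)).aestronglyMeasurable)
      (hχi.const_mul (B * (1 + ‖z‖) ^ (-((n : ℝ) + α))))
      (fun k => Eventually.of_forall (hb k z)) (Eventually.of_forall fun y => ?_)
    refine Tendsto.mul_const _ ((hη'.tendsto z).comp ?_)
    simpa using (ht0.smul_const y).const_sub z

theorem ae_eq_mollify (hα0 : 0 < α) (hα2 : α < 2)
    {u : EuclideanSpace ℝ (Fin n) → ℝ} (hu : InLalpha n α u)
    (χ : SchwartzMap (EuclideanSpace ℝ (Fin n)) ℝ) (hχ : ∫ x, χ x = 1)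
    (hscale : ∀ R : ℝ, 0 < R → ∀ x,
      ∫ z, u z * ((R ^ n)⁻¹ * χ (R⁻¹ • (z - x))) = ∫ z, u z * χ (z - x)) :
    ∀ᵐ x, u x = ∫ z, u z * χ (z - x) := by
  refine ae_eq_of_integral_contDiff_smul_eq (hu.locallyIntegrable hα0)
    (continuous_integral_mul_translate hα0 hα2 hu χ).locallyIntegrable fun η hη hc => ?_
  have h1 := tendsto_integral_mul_mollify hα0 hα2 hu χ hχ hη hc
  have h2 : ∀ k : ℕ, ∫ z, u z * ∫ y, η (z - (1 / ((k : ℝ) + 1)) • y) * χ y =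
      ∫ x, η x * ∫ z, u z * χ (z - x) := by
    intro k
    rw [← integral_mul_mollify_eq hα0 hα2 hu χ hη.continuous hc (by positivity)]
    simp only [hscale _ (by positivity : (0 : ℝ) < 1 / ((k : ℝ) + 1))]
  simp only [h2] at h1
  have h3 := tendsto_nhds_unique h1 tendsto_const_nhds
  simp only [smul_eq_mul]
  rw [← h3]
  simp only [mul_comm]

theorem secondDiff_eq_zero_of_scale_invariant (hα0 : 0 < α) (hα2 : α < 2)
    {u : EuclideanSpace ℝ (Fin n) → ℝ} (hu : InLalpha n α u)
    (χ : SchwartzMap (EuclideanSpace ℝ (Fin n)) ℝ)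
    (hscale : ∀ R : ℝ, 0 < R → ∀ x,
      ∫ z, u z * ((R ^ n)⁻¹ * χ (R⁻¹ • (z - x))) = ∫ z, u z * χ (z - x))
    (x a : EuclideanSpace ℝ (Fin n)) :
    secondDiff (fun x => ∫ z, u z * χ (z - x)) x a = 0 := by
  have hp : (0 : ℝ) ≤ n + α := by positivity
  have hn0 : (0 : ℝ) ≤ n := by positivity
  obtain ⟨A, hA⟩ := χ.exists_decayBound
  have hA0 := hA.nonneg
  set V : EuclideanSpace ℝ (Fin n) → ℝ := fun x => ∫ z, u z * χ (z - x) with hV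
  set C := A * ‖a‖ ^ 2 * ((1 + ‖x‖) * 2) ^ ((n : ℝ) + α) *
    ∫ z, ‖u z‖ * (1 + ‖z‖) ^ (-((n : ℝ) + α))
  have key : ∀ R : ℝ, 1 ≤ R → ‖a‖ ≤ R → ‖secondDiff V x a‖ ≤ C * R ^ (-(2 - α)) := by
    intro R hR1 hRa
    have hR : 0 < R := by linarith
    have hi : ∀ x, Integrable fun z => u z * ((R ^ n)⁻¹ * χ (R⁻¹ • (z - x))) := fun x =>
      ((hu.integrable_mul_schwartz_comp hα0 hα2 χ (inv_pos.2 hR) x).const_mul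
        (R ^ n)⁻¹).congr (Eventually.of_forall fun z => by simp only; ring)
    have e1 := integral_add (hi x) (hi x)
    have e2 := integral_sub ((hi x).add (hi x)) (hi (x + a))
    have e3 := integral_sub (((hi x).add (hi x)).sub (hi (x + a))) (hi (x - a))
    simp only [Pi.add_apply, Pi.sub_apply] at e1 e2 e3
    have e4 : secondDiff V x a =
        ∫ z, u z * ((R ^ n)⁻¹ * secondDiff χ (R⁻¹ • (z - x)) (R⁻¹ • a)) := by
      simp only [secondDiff, hV]
      rw [← hscale R hR x, ← hscale R hR (x + a), ← hscale R hR (x - a), ← e1, ← e2, ← e3]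
      refine integral_congr_ae (Eventually.of_forall fun z => ?_)
      have s1 : R⁻¹ • (z - x) + R⁻¹ • a = R⁻¹ • (z - (x - a)) := by
        rw [← smul_add]; congr 1; abel
      have s2 : R⁻¹ • (z - x) - R⁻¹ • a = R⁻¹ • (z - (x + a)) := by
        rw [← smul_sub]; congr 1; abel
      simp only [s1, s2]
      ring
    have hR2 : ‖R⁻¹ • a‖ = ‖a‖ / R := by
      rw [norm_smul, Real.norm_of_nonneg (by positivity), div_eq_inv_mul]
    have hb : ∀ z, ‖u z * ((R ^ n)⁻¹ * secondDiff χ (R⁻¹ • (z - x)) (R⁻¹ • a))‖ ≤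
        A * ‖a‖ ^ 2 * ((1 + ‖x‖) * 2) ^ ((n : ℝ) + α) * R ^ (-(2 - α)) *
          (‖u z‖ * (1 + ‖z‖) ^ (-((n : ℝ) + α))) := by
      intro z
      have h1 := hA.diff2 (R⁻¹ • (z - x)) (R⁻¹ • a) (by rw [hR2]; exact (div_le_one hR).2 hRa)
      have h2 := one_add_norm_smul_sub_rpow_le hp (inv_pos.2 hR) x z
      have h3 : (1 + ‖R⁻¹ • (z - x)‖) ^ (-(2 * (n : ℝ) + 2)) ≤
          (1 + ‖R⁻¹ • (z - x)‖) ^ (-((n : ℝ) + α)) :=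
        Real.rpow_le_rpow_of_exponent_le (by linarith [norm_nonneg (R⁻¹ • (z - x))])
          (by linarith)
      have h4 : ((1 + ‖x‖) * (1 + R⁻¹⁻¹)) ^ ((n : ℝ) + α) ≤
          ((1 + ‖x‖) * 2) ^ ((n : ℝ) + α) * R ^ ((n : ℝ) + α) := by
        rw [← Real.mul_rpow (by positivity) hR.le, inv_inv, mul_assoc]
        gcongr
        linarith
      have h5 : (R ^ n)⁻¹ * ((‖a‖ / R) ^ 2 * R ^ ((n : ℝ) + α)) =
          ‖a‖ ^ 2 * R ^ (-(2 - α)) := by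
        rw [Real.rpow_add hR, Real.rpow_natCast, neg_sub, Real.rpow_sub hR,
          show (2 : ℝ) = (2 : ℕ) by norm_num, Real.rpow_natCast]
        field_simp
      rw [hR2] at h1
      rw [norm_mul, norm_mul, norm_inv, norm_pow, Real.norm_of_nonneg hR.le]
      calc ‖u z‖ * ((R ^ n)⁻¹ * ‖secondDiff χ (R⁻¹ • (z - x)) (R⁻¹ • a)‖)
          ≤ ‖u z‖ * ((R ^ n)⁻¹ * (A * (‖a‖ / R) ^ 2 * ((((1 + ‖x‖) * 2) ^ ((n : ℝ) + α) *
            R ^ ((n : ℝ) + α)) * (1 + ‖z‖) ^ (-((n : ℝ) + α))))) := by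
            gcongr
            refine h1.trans ?_
            gcongr
            exact (h3.trans h2).trans (by gcongr)
        _ = A * ((1 + ‖x‖) * 2) ^ ((n : ℝ) + α) *
            ((R ^ n)⁻¹ * ((‖a‖ / R) ^ 2 * R ^ ((n : ℝ) + α))) *
            (‖u z‖ * (1 + ‖z‖) ^ (-((n : ℝ) + α))) := by ring
        _ = _ := by rw [h5]; ring
    rw [e4]
    refine (norm_integral_le_of_norm_le ((hu.integrable_mul_japanese hα0).const_mul _)
      (Eventually.of_forall hb)).trans_eq ?_
    rw [integral_const_mul]
    ring
  have hlim : Tendsto (fun R : ℝ => C * R ^ (-(2 - α))) atTop (𝓝 0) := by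
    simpa using (tendsto_rpow_neg_atTop (by linarith : 0 < 2 - α)).const_mul C
  refine norm_le_zero_iff.1 (ge_of_tendsto hlim ?_)
  filter_upwards [eventually_ge_atTop 1, eventually_ge_atTop ‖a‖] with R h1 h2 using key R h1 h2

theorem exists_affine_of_secondDiff_eq_zero {v : EuclideanSpace ℝ (Fin n) → ℝ}
    (hv : Continuous v) (h : ∀ x a, secondDiff v x a = 0) :
    ∃ (L : EuclideanSpace ℝ (Fin n) →L[ℝ] ℝ), ∀ x, v x = L x + v 0 := by
  have h2 : ∀ x a, v (x + a) + v (x - a) = 2 * v x := fun x a => by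
    have := h x a
    simp only [secondDiff] at this
    linarith
  let f : EuclideanSpace ℝ (Fin n) →+ ℝ :=
    { toFun := fun x => v x - v 0
      map_zero' := sub_self _
      map_add' := fun x y => by
        have e1 := h2 ((2⁻¹ : ℝ) • (x + y)) ((2⁻¹ : ℝ) • (x - y))
        have e2 := h2 ((2⁻¹ : ℝ) • (x + y)) ((2⁻¹ : ℝ) • (x + y))
        rw [← smul_add, ← smul_sub, show x + y + (x - y) = (2 : ℝ) • x by rw [two_smul]; abel,
          show x + y - (x - y) = (2 : ℝ) • y by rw [two_smul]; abel,
          inv_smul_smul₀ two_ne_zero, inv_smul_smul₀ two_ne_zero] at e1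
        rw [sub_self, ← add_smul, show (2⁻¹ : ℝ) + 2⁻¹ = 1 by norm_num, one_smul] at e2
        linarith }
  refine ⟨f.toRealLinearMap (hv.sub continuous_const), fun x => ?_⟩
  simp [f]

/-- **Liouville theorem**: a distributionally `α`-harmonic function in `L_α` is a.e. affine. -/
theorem AlphaHarmonic.ae_eq_affine (hn : 1 ≤ n) (hα0 : 0 < α) (hα2 : α < 2)
    {u : EuclideanSpace ℝ (Fin n) → ℝ} (hu : InLalpha n α u) (h : AlphaHarmonic n α u) :
    ∃ (L : EuclideanSpace ℝ (Fin n) →L[ℝ] ℝ) (c : ℝ), ∀ᵐ x, u x = L x + c := by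
  obtain ⟨χ, hχ, hscale⟩ := exists_scale_invariant_mollifier hn hα0 hα2
  obtain ⟨L, hL⟩ := exists_affine_of_secondDiff_eq_zero
    (continuous_integral_mul_translate hα0 hα2 hu χ)
    (secondDiff_eq_zero_of_scale_invariant hα0 hα2 hu χ (hscale u hu h))
  exact ⟨L, _, (ae_eq_mollify hα0 hα2 hu χ hχ (hscale u hu h)).mono fun x hx => hx.trans (hL x)⟩

end Liouville

section AvgKernel

variable {n : ℕ} {α : ℝ}

/-- The normalizing constant of `avgKernel`. -/
def avgConst (n : ℕ) (α : ℝ) : ℝ :=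
  Real.Gamma ((n : ℝ) / 2) / Real.pi ^ ((n : ℝ) / 2 + 1) * Real.sin (Real.pi * α / 2)

theorem sin_pi_mul_div_two_pos (hα0 : 0 < α) (hα2 : α < 2) : 0 < Real.sin (Real.pi * α / 2) := by
  refine Real.sin_pos_of_pos_of_lt_pi (by positivity) ?_
  nlinarith [Real.pi_pos]

theorem avgConst_pos (hn : 1 ≤ n) (hα0 : 0 < α) (hα2 : α < 2) : 0 < avgConst n α := by
  have h1 : (0 : ℝ) < n := by exact_mod_cast hn
  have h2 : 0 < Real.Gamma ((n : ℝ) / 2) := Real.Gamma_pos_of_pos (by positivity)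
  have h3 := sin_pi_mul_div_two_pos hα0 hα2
  unfold avgConst
  positivity

theorem avgKernel_of_lt {r : ℝ} {x : EuclideanSpace ℝ (Fin n)} (h : r < ‖x‖) :
    avgKernel n α r x = avgConst n α * (r ^ α / ((‖x‖ ^ 2 - r ^ 2) ^ (α / 2) * ‖x‖ ^ n)) :=
  if_pos h

theorem avgKernel_of_le {r : ℝ} {x : EuclideanSpace ℝ (Fin n)} (h : ‖x‖ ≤ r) :
    avgKernel n α r x = 0 :=
  if_neg (not_lt.2 h)

theorem avgKernel_nonneg (hn : 1 ≤ n) (hα0 : 0 < α) (hα2 : α < 2) {r : ℝ} (hr : 0 < r)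
    (x : EuclideanSpace ℝ (Fin n)) : 0 ≤ avgKernel n α r x := by
  rcases lt_or_ge r ‖x‖ with h | h
  · rw [avgKernel_of_lt h]
    have h1 := avgConst_pos hn hα0 hα2
    have h2 : 0 ≤ ‖x‖ ^ 2 - r ^ 2 := by nlinarith
    positivity
  · rw [avgKernel_of_le h]

theorem avgKernel_neg (r : ℝ) (x : EuclideanSpace ℝ (Fin n)) :
    avgKernel n α r (-x) = avgKernel n α r x := by
  simp only [avgKernel, norm_neg]

theorem measurable_avgKernel (r : ℝ) : Measurable (avgKernel n α r) := by
  unfold avgKernel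
  refine Measurable.ite (measurableSet_lt measurable_const measurable_norm) ?_ measurable_const
  fun_prop

theorem avgKernel_eq_smul {r : ℝ} (hr : 0 < r) (x : EuclideanSpace ℝ (Fin n)) :
    avgKernel n α r x = (r ^ n)⁻¹ * avgKernel n α 1 (r⁻¹ • x) := by
  have hx : ‖r⁻¹ • x‖ = ‖x‖ / r := by
    rw [norm_smul, norm_inv, Real.norm_of_nonneg hr.le, div_eq_inv_mul]
  rcases lt_or_ge r ‖x‖ with h | h
  · have h2 : 0 ≤ ‖x‖ ^ 2 - r ^ 2 := by nlinarith
    have h3 : (r ^ 2) ^ (α / 2) = r ^ α := by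
      rw [← Real.rpow_natCast r 2, ← Real.rpow_mul hr.le]
      congr 1
      push_cast
      ring
    rw [avgKernel_of_lt h, avgKernel_of_lt (by rwa [hx, one_lt_div hr]), hx,
      show (‖x‖ / r) ^ 2 - 1 ^ 2 = (‖x‖ ^ 2 - r ^ 2) / r ^ 2 by field_simp,
      Real.div_rpow h2 (by positivity), h3, Real.one_rpow, div_pow]
    field_simp
  · rw [avgKernel_of_le h, avgKernel_of_le (by rwa [hx, div_le_one hr]), mul_zero]

theorem integral_betaPDFReal_Ioi {a b : ℝ} (ha : 0 < a) (hb : 0 < b) :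
    ∫ x in Set.Ioi (0 : ℝ), ProbabilityTheory.betaPDFReal a b x = 1 := by
  have hnn : ∀ x, 0 ≤ ProbabilityTheory.betaPDFReal a b x := by
    intro x
    by_cases h : 0 < x ∧ x < 1
    · exact (ProbabilityTheory.betaPDFReal_pos h.1 h.2 ha hb).le
    · exact (if_neg h).ge
  have h0 : ∀ x, x ∉ Set.Ioi (0 : ℝ) → ProbabilityTheory.betaPDFReal a b x = 0 := fun x hx =>
    if_neg fun h => hx h.1
  rw [setIntegral_eq_integral_of_forall_compl_eq_zero h0,
    integral_eq_lintegral_of_nonneg_ae (Eventually.of_forall hnn)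
      (ProbabilityTheory.measurable_betaPDFReal a b).aestronglyMeasurable]
  have := ProbabilityTheory.lintegral_betaPDF_eq_one ha hb
  unfold ProbabilityTheory.betaPDF at this
  rw [this, ENNReal.toReal_one]

theorem integral_radial_avgKernel (hα0 : 0 < α) (hα2 : α < 2) :
    ∫ t in Set.Ioi (0 : ℝ), (if 1 < t then t⁻¹ * (t ^ 2 - 1) ^ (-(α / 2)) else 0) =
      Real.pi / (2 * Real.sin (Real.pi * α / 2)) := by
  have hs := sin_pi_mul_div_two_pos hα0 hα2
  have h1 := integral_comp_rpow_Ioi (ProbabilityTheory.betaPDFReal (α / 2) (1 - α / 2))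
    (p := -2) (by norm_num)
  rw [integral_betaPDFReal_Ioi (by linarith) (by linarith)] at h1
  have h2 : ∀ t ∈ Set.Ioi (0 : ℝ), (|(-2 : ℝ)| * t ^ ((-2 : ℝ) - 1)) •
      ProbabilityTheory.betaPDFReal (α / 2) (1 - α / 2) (t ^ (-2 : ℝ)) =
      2 * Real.sin (Real.pi * α / 2) / Real.pi *
        (if 1 < t then t⁻¹ * (t ^ 2 - 1) ^ (-(α / 2)) else 0) := by
    intro t ht
    have ht : 0 < t := ht
    have hpos : 0 < t ^ (-2 : ℝ) := Real.rpow_pos_of_pos ht _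
    by_cases h : 1 < t
    · have hlt : t ^ (-2 : ℝ) < 1 := Real.rpow_lt_one_of_one_lt_of_neg h (by norm_num)
      have hb : ProbabilityTheory.beta (α / 2) (1 - α / 2) =
          Real.pi / Real.sin (Real.pi * α / 2) := by
        unfold ProbabilityTheory.beta
        rw [Real.Gamma_mul_Gamma_one_sub, add_sub_cancel, Real.Gamma_one, div_one, mul_div_assoc]
      have h3 : 1 - t ^ (-2 : ℝ) = (t ^ 2 - 1) * t ^ (-2 : ℝ) := by
        rw [Real.rpow_neg ht.le, Real.rpow_two]
        field_simp
      have h4 : (0 : ℝ) ≤ t ^ 2 - 1 := by nlinarith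
      rw [if_pos h, ProbabilityTheory.betaPDFReal, if_pos ⟨hpos, hlt⟩, hb, h3,
        Real.mul_rpow h4 hpos.le, ← Real.rpow_mul ht.le, ← Real.rpow_mul ht.le, smul_eq_mul,
        show (1 - α / 2 - 1) = -(α / 2) by ring, ← Real.rpow_neg_one t]
      have h5 : t ^ ((-2 : ℝ) - 1) * t ^ (-2 * (α / 2 - 1)) * t ^ (-2 * -(α / 2)) =
          t ^ (-1 : ℝ) := by
        rw [← Real.rpow_add ht, ← Real.rpow_add ht]
        congr 1
        ring
      rw [← h5]
      norm_num
      field_simp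
    · have hle : ¬ t ^ (-2 : ℝ) < 1 :=
        not_lt.2 (Real.one_le_rpow_of_pos_of_le_one_of_nonpos ht (not_lt.1 h) (by norm_num))
      rw [if_neg h, ProbabilityTheory.betaPDFReal, if_neg fun h' => hle h'.2, smul_zero, mul_zero]
  rw [setIntegral_congr_fun measurableSet_Ioi h2, integral_const_mul] at h1
  have hpi := Real.pi_pos
  field_simp at h1 ⊢
  linarith

theorem integral_avgKernel_one (hn : 1 ≤ n) (hα0 : 0 < α) (hα2 : α < 2) :
    ∫ x : EuclideanSpace ℝ (Fin n), avgKernel n α 1 x = 1 := by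
  have : Nonempty (Fin n) := ⟨⟨0, hn⟩⟩
  have hn0 : (0 : ℝ) < n := by exact_mod_cast hn
  have hs := sin_pi_mul_div_two_pos hα0 hα2
  have h1 := integral_fun_norm_addHaar (volume : Measure (EuclideanSpace ℝ (Fin n)))
    (fun t : ℝ => if 1 < t then
      avgConst n α * (1 ^ α / ((t ^ 2 - 1 ^ 2) ^ (α / 2) * t ^ n)) else 0)
  have h2 : ∀ t ∈ Set.Ioi (0 : ℝ), t ^ (n - 1) • (if 1 < t then
      avgConst n α * (1 ^ α / ((t ^ 2 - 1 ^ 2) ^ (α / 2) * t ^ n)) else 0) =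
      avgConst n α * (if 1 < t then t⁻¹ * (t ^ 2 - 1) ^ (-(α / 2)) else 0) := by
    intro t ht
    have ht : 0 < t := ht
    by_cases h : 1 < t
    · have h4 : (0 : ℝ) < t ^ 2 - 1 := by nlinarith
      obtain ⟨m, rfl⟩ : ∃ m, n = m + 1 := ⟨n - 1, by omega⟩
      rw [if_pos h, if_pos h, Real.rpow_neg h4.le, Real.one_rpow, one_pow, smul_eq_mul,
        Nat.add_sub_cancel]
      field_simp
      ring
    · simp [h]
  rw [finrank_euclideanSpace_fin, setIntegral_congr_fun measurableSet_Ioi h2, integral_const_mul,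
    integral_radial_avgKernel hα0 hα2] at h1
  refine Eq.trans h1 ?_
  have hG : 0 < Real.Gamma ((n : ℝ) / 2) := Real.Gamma_pos_of_pos (by positivity)
  have hvol : (volume : Measure (EuclideanSpace ℝ (Fin n))).real (ball 0 1) =
      Real.pi ^ ((n : ℝ) / 2) / ((n : ℝ) / 2 * Real.Gamma ((n : ℝ) / 2)) := by
    rw [measureReal_def, EuclideanSpace.volume_ball, ← Real.Gamma_add_one (by positivity),
      Fintype.card_fin, ENNReal.ofReal_one, one_pow, one_mul, ENNReal.toReal_ofReal,
      Real.sqrt_eq_rpow, ← Real.rpow_natCast, ← Real.rpow_mul Real.pi_pos.le]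
    · congr 2
      ring
    · have : 0 < Real.Gamma ((n : ℝ) / 2 + 1) := Real.Gamma_pos_of_pos (by positivity)
      positivity
  rw [hvol, avgConst, Real.rpow_add Real.pi_pos, Real.rpow_one, nsmul_eq_mul, smul_eq_mul]
  have hpi := Real.pi_pos
  field_simp

theorem integral_avgKernel (hn : 1 ≤ n) (hα0 : 0 < α) (hα2 : α < 2) {r : ℝ} (hr : 0 < r) :
    ∫ x : EuclideanSpace ℝ (Fin n), avgKernel n α r x = 1 := by
  simp only [avgKernel_eq_smul hr]
  rw [integral_const_mul, Measure.integral_comp_smul_of_nonneg volume (avgKernel n α 1) r⁻¹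
    (hR := (inv_pos.2 hr).le), integral_avgKernel_one hn hα0 hα2, finrank_euclideanSpace_fin]
  simp [hr.ne']

theorem integrable_avgKernel (hn : 1 ≤ n) (hα0 : 0 < α) (hα2 : α < 2) {r : ℝ} (hr : 0 < r) :
    Integrable (avgKernel n α r : EuclideanSpace ℝ (Fin n) → ℝ) :=
  Integrable.of_integral_ne_zero (by rw [integral_avgKernel hn hα0 hα2 hr]; exact one_ne_zero)

theorem avgKernel_le_of_two_mul_lt (hn : 1 ≤ n) (hα0 : 0 < α) (hα2 : α < 2) {r : ℝ} (hr : 0 < r)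
    {x : EuclideanSpace ℝ (Fin n)} (hx : 2 * r < ‖x‖) :
    avgKernel n α r x ≤ avgConst n α * r ^ α * (2 ^ α * ‖x‖ ^ (-((n : ℝ) + α))) := by
  have hx0 : 0 < ‖x‖ := by linarith
  have hc := avgConst_pos hn hα0 hα2
  rw [avgKernel_of_lt (by linarith), mul_assoc, div_eq_mul_inv]
  gcongr
  have h1 : (‖x‖ / 2) ^ α ≤ (‖x‖ ^ 2 - r ^ 2) ^ (α / 2) := by
    have h2 : (‖x‖ / 2) ^ α = ((‖x‖ / 2) ^ 2) ^ (α / 2) := by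
      rw [← Real.rpow_natCast _ 2, ← Real.rpow_mul (by positivity)]
      congr 1
      push_cast
      ring
    rw [h2]
    exact Real.rpow_le_rpow (by positivity) (by nlinarith) (by positivity)
  calc ((‖x‖ ^ 2 - r ^ 2) ^ (α / 2) * ‖x‖ ^ n)⁻¹ ≤ ((‖x‖ / 2) ^ α * ‖x‖ ^ n)⁻¹ := by gcongr
    _ = 2 ^ α * ‖x‖ ^ (-((n : ℝ) + α)) := by
      rw [Real.div_rpow hx0.le (by norm_num), Real.rpow_neg hx0.le, Real.rpow_add hx0,
        Real.rpow_natCast]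
      field_simp

theorem exists_avgKernel_le_japanese (hn : 1 ≤ n) (hα0 : 0 < α) (hα2 : α < 2) {r : ℝ}
    (hr : 0 < r) : ∃ C : ℝ, 0 ≤ C ∧ ∀ x : EuclideanSpace ℝ (Fin n), 2 * r < ‖x‖ →
      avgKernel n α r x ≤ C * (1 + ‖x‖) ^ (-((n : ℝ) + α)) := by
  have hc := avgConst_pos hn hα0 hα2
  refine ⟨avgConst n α * r ^ α * (2 ^ α * (1 + (2 * r)⁻¹) ^ ((n : ℝ) + α)), by positivity,
    fun x hx => (avgKernel_le_of_two_mul_lt hn hα0 hα2 hr hx).trans ?_⟩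
  rw [mul_assoc _ (2 ^ α * _), mul_assoc (2 ^ α)]
  gcongr
  exact norm_rpow_neg_le_of_lt (by positivity) (by positivity) hx

theorem avgConv_eq (r : ℝ) (w : EuclideanSpace ℝ (Fin n) → ℝ) (x : EuclideanSpace ℝ (Fin n)) :
    avgConv n α r w x = ∫ y, avgKernel n α r (x - y) * w y := by
  refine setIntegral_eq_integral_of_forall_compl_eq_zero fun y hy => ?_
  rw [avgKernel_of_le, zero_mul]
  rw [norm_sub_rev]
  exact not_lt.1 hy

theorem avgConv_eq' (r : ℝ) (w : EuclideanSpace ℝ (Fin n) → ℝ) (x : EuclideanSpace ℝ (Fin n)) :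
    avgConv n α r w x = ∫ y, avgKernel n α r y * w (x - y) := by
  rw [avgConv_eq, ← integral_sub_left_eq_self (fun y => avgKernel n α r (x - y) * w y) volume x]
  simp only [sub_sub_cancel]

theorem inLalpha_const (hα0 : 0 < α) (c : ℝ) :
    InLalpha n α fun _ : EuclideanSpace ℝ (Fin n) => c :=
  InLalpha.of_integrable_mul_japanese hα0 aestronglyMeasurable_const
    ((integrable_japanese (by linarith)).const_mul _)

theorem avgConv_affine (hn : 1 ≤ n) (hα0 : 0 < α) (hα2 : α < 2)
    (L : EuclideanSpace ℝ (Fin n) →L[ℝ] ℝ) (c : ℝ) (hL : InLalpha n α fun x => L x + c)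
    (x : EuclideanSpace ℝ (Fin n)) {r : ℝ} (hr : 0 < r) :
    avgConv n α r (fun x => L x + c) x = L x + c := by
  have hL' : InLalpha n α L := by
    have := Integrable.sub hL (inLalpha_const hα0 c)
    refine this.congr (Eventually.of_forall fun x => ?_)
    simp only [Pi.sub_apply]
    ring
  obtain ⟨C, hC0, hC⟩ := exists_avgKernel_le_japanese (n := n) hn hα0 hα2 hr
  have hK := integrable_avgKernel (n := n) hn hα0 hα2 hr
  have hnn := avgKernel_nonneg (n := n) hn hα0 hα2 hr
  have hi : Integrable fun y => avgKernel n α r y * L y := by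
    refine ((hK.mul_const (‖L‖ * (2 * r))).add
      ((hL'.integrable_mul_japanese hα0).const_mul C)).mono'
      (hK.aestronglyMeasurable.mul L.continuous.aestronglyMeasurable)
      (Eventually.of_forall fun y => ?_)
    rw [norm_mul, Real.norm_of_nonneg (hnn y), Pi.add_apply]
    rcases lt_or_ge (2 * r) ‖y‖ with h | h
    · refine le_add_of_nonneg_of_le (mul_nonneg (hnn y) (by positivity)) ?_
      calc avgKernel n α r y * ‖L y‖ ≤ C * (1 + ‖y‖) ^ (-((n : ℝ) + α)) * ‖L y‖ := by
            gcongr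
            exact hC y h
        _ = _ := by ring
    · refine le_add_of_le_of_nonneg ?_ (by positivity)
      exact mul_le_mul_of_nonneg_left ((L.le_opNorm y).trans (by gcongr)) (hnn y)
  have hodd : ∫ y, avgKernel n α r y * L y = 0 := by
    have h1 := integral_neg_eq_self (fun y => avgKernel n α r y * L y) volume
    simp only [avgKernel_neg, map_neg, mul_neg, integral_neg] at h1
    linarith
  have hsplit : ∀ y, avgKernel n α r y * (L (x - y) + c) =
      avgKernel n α r y * (L x + c) - avgKernel n α r y * L y := by
    intro y
    rw [map_sub]
    ring
  rw [avgConv_eq']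
  simp only [hsplit]
  rw [integral_sub (hK.mul_const _) hi, integral_mul_const, integral_avgKernel hn hα0 hα2 hr, hodd]
  ring

end AvgKernel

section MeanValue

variable {n : ℕ} {α : ℝ}

theorem integrable_mul_avgKernel_mul (hn : 1 ≤ n) (hα0 : 0 < α) (hα2 : α < 2)
    {u φ : EuclideanSpace ℝ (Fin n) → ℝ} (hu : InLalpha n α u) (huc : Continuous u)
    (hφ : Continuous φ) (hc : HasCompactSupport φ) {r : ℝ} (hr : 0 < r) :
    Integrable (fun p : EuclideanSpace ℝ (Fin n) × EuclideanSpace ℝ (Fin n) =>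
      φ p.1 * (avgKernel n α r (p.1 - p.2) * u p.2)) (volume.prod volume) := by
  obtain ⟨C, hC0, hC⟩ := exists_avgKernel_le_japanese hn hα0 hα2 hr
  obtain ⟨M, hM⟩ := (hc.isCompact.cthickening (r := 2 * r)).exists_bound_of_continuousOn
    huc.continuousOn
  have hp : (0 : ℝ) ≤ n + α := by positivity
  have hw : Continuous fun x : EuclideanSpace ℝ (Fin n) =>
      ‖φ x‖ * (C * (1 + ‖x‖) ^ ((n : ℝ) + α)) := by
    refine hφ.norm.mul (continuous_const.mul ?_)
    exact Continuous.rpow_const (by fun_prop) fun x => Or.inr hp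
  have h1 := (hw.integrable_of_hasCompactSupport hc.norm.mul_right (μ := volume)).mul_prod
    (hu.integrable_mul_japanese hα0)
  have hφi : Integrable φ := hφ.integrable_of_hasCompactSupport hc
  have h2 := ((hφi.norm.convolution_integrand (ContinuousLinearMap.mul ℝ ℝ)
    (integrable_avgKernel hn hα0 hα2 hr) (μ := volume) (ν := volume)).swap).const_mul M
  refine (h1.add h2).mono' ?_ (Eventually.of_forall fun p => ?_)
  · refine AEStronglyMeasurable.mul ?_ (AEStronglyMeasurable.mul ?_ ?_)
    · exact (hφ.comp continuous_fst).aestronglyMeasurable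
    · exact ((measurable_avgKernel r).comp
        (measurable_fst.sub measurable_snd)).aestronglyMeasurable
    · exact (huc.comp continuous_snd).aestronglyMeasurable
  · obtain ⟨x, z⟩ := p
    have hK := avgKernel_nonneg hn hα0 hα2 hr (x - z)
    simp only [Pi.add_apply, Function.comp_apply, Prod.swap_prod_mk, norm_mul,
      ContinuousLinearMap.mul_apply', Real.norm_of_nonneg hK]
    rw [← neg_sub x z, avgKernel_neg]
    have hφ0 : 0 ≤ ‖φ x‖ := norm_nonneg _
    have hu0 : 0 ≤ ‖u z‖ := norm_nonneg _
    by_cases hx : x ∈ tsupport φ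
    · have hM0 : 0 ≤ M := (norm_nonneg _).trans (hM x (self_subset_cthickening _ hx))
      rcases lt_or_ge (2 * r) ‖x - z‖ with h | h
      · refine le_add_of_le_of_nonneg ?_ (by positivity)
        have h3 := one_add_norm_rpow_neg_le hp z (z - x)
        rw [sub_sub_cancel, norm_sub_rev z x] at h3
        calc ‖φ x‖ * (avgKernel n α r (x - z) * ‖u z‖)
            ≤ ‖φ x‖ * (C * ((1 + ‖x‖) ^ ((n : ℝ) + α) * (1 + ‖z‖) ^ (-((n : ℝ) + α))) *
              ‖u z‖) := by
              gcongr
              exact (hC _ h).trans (by gcongr)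
          _ = _ := by ring
      · refine le_add_of_nonneg_of_le (by positivity) ?_
        have h3 : ‖u z‖ ≤ M := by
          refine hM z (mem_cthickening_of_dist_le z x _ _ hx ?_)
          rwa [dist_comm, dist_eq_norm]
        calc ‖φ x‖ * (avgKernel n α r (x - z) * ‖u z‖)
            ≤ ‖φ x‖ * (avgKernel n α r (x - z) * M) := by gcongr
          _ = _ := by ring
    · simp [image_eq_zero_of_notMem_tsupport hx]

theorem integral_mul_avgKernel_secondDiff (hn : 1 ≤ n) (hα0 : 0 < α) (hα2 : α < 2)
    {u φ : EuclideanSpace ℝ (Fin n) → ℝ} (hu : InLalpha n α u) (huc : Continuous u)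
    (hφ : Continuous φ) (hc : HasCompactSupport φ) {r : ℝ} (hr : 0 < r)
    (hmv : ∀ x, avgConv n α r u x = u x) :
    ∫ z, u z * ∫ y, avgKernel n α r y * secondDiff φ z y = 0 := by
  have hint := integrable_mul_avgKernel_mul hn hα0 hα2 hu huc hφ hc hr
  have hK := integrable_avgKernel hn hα0 hα2 hr
  obtain ⟨C, hC⟩ := hc.exists_bound_of_continuous hφ
  have hT : ∀ z, ∫ y, avgKernel n α r y * secondDiff φ z y =
      2 * (φ z - ∫ x, avgKernel n α r (z - x) * φ x) := by
    intro z
    have hKz : Integrable fun x => avgKernel n α r (z - x) := hK.comp_sub_left z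
    rw [← two_mul_integral_even_kernel hK (avgKernel_neg r) hφ hC z]
    simp only [mul_sub]
    rw [integral_sub (hKz.mul_const _)
      (hKz.mul_bdd hφ.aestronglyMeasurable (Eventually.of_forall hC)),
      integral_mul_const, integral_sub_left_eq_self (avgKernel n α r) volume z,
      integral_avgKernel hn hα0 hα2 hr]
    ring
  have e1 : ∀ x, ∫ z, φ x * (avgKernel n α r (x - z) * u z) = u x * φ x := by
    intro x
    rw [integral_const_mul, ← avgConv_eq, hmv, mul_comm]
  have e2 : ∀ z, ∫ x, φ x * (avgKernel n α r (x - z) * u z) =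
      u z * ∫ x, avgKernel n α r (z - x) * φ x := by
    intro z
    rw [← integral_const_mul]
    refine integral_congr_ae (Eventually.of_forall fun x => ?_)
    simp only
    rw [← neg_sub z x, avgKernel_neg]
    ring
  have h1 : Integrable fun z => u z * φ z :=
    (huc.mul hφ).integrable_of_hasCompactSupport hc.mul_left
  have h2 : Integrable fun z => u z * ∫ x, avgKernel n α r (z - x) * φ x := by
    simpa only [e2] using hint.integral_prod_right
  have hswap := integral_integral_swap
    (f := fun x z => φ x * (avgKernel n α r (x - z) * u z)) hint
  simp only [e1, e2] at hswap
  have e3 : ∀ z, u z * ∫ y, avgKernel n α r y * secondDiff φ z y =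
      2 * (u z * φ z - u z * ∫ x, avgKernel n α r (z - x) * φ x) := by
    intro z
    rw [hT]
    ring
  simp only [e3]
  rw [integral_const_mul, integral_sub h1 h2, hswap, sub_self, mul_zero]

/-- `avgKernel`, normalized to behave like `‖y‖ ^ (-(n + α))` for small `r`. -/
def scaledKernel (n : ℕ) (α r : ℝ) (y : EuclideanSpace ℝ (Fin n)) : ℝ :=
  (avgConst n α * r ^ α)⁻¹ * avgKernel n α r y

theorem scaledKernel_nonneg (hn : 1 ≤ n) (hα0 : 0 < α) (hα2 : α < 2) {r : ℝ} (hr : 0 < r)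
    (y : EuclideanSpace ℝ (Fin n)) : 0 ≤ scaledKernel n α r y := by
  have h1 := avgConst_pos hn hα0 hα2
  have h2 := avgKernel_nonneg hn hα0 hα2 hr y
  unfold scaledKernel
  positivity

theorem integrable_scaledKernel (hn : 1 ≤ n) (hα0 : 0 < α) (hα2 : α < 2) {r : ℝ} (hr : 0 < r) :
    Integrable (scaledKernel n α r) :=
  (integrable_avgKernel hn hα0 hα2 hr).const_mul _

theorem scaledKernel_le (hn : 1 ≤ n) (hα0 : 0 < α) (hα2 : α < 2) {r : ℝ} (hr : 0 < r)
    {y : EuclideanSpace ℝ (Fin n)} (hy : 2 * r < ‖y‖) :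
    scaledKernel n α r y ≤ 2 ^ α * ‖y‖ ^ (-((n : ℝ) + α)) := by
  have h1 := avgConst_pos hn hα0 hα2
  have h2 : 0 < r ^ α := Real.rpow_pos_of_pos hr _
  rw [scaledKernel, inv_mul_le_iff₀ (by positivity)]
  exact avgKernel_le_of_two_mul_lt hn hα0 hα2 hr hy

theorem tendsto_scaledKernel (hn : 1 ≤ n) (hα0 : 0 < α) (hα2 : α < 2)
    {y : EuclideanSpace ℝ (Fin n)} (hy : y ≠ 0) :
    Tendsto (fun r => scaledKernel n α r y) (𝓝[>] 0) (𝓝 (‖y‖ ^ (-((n : ℝ) + α)))) := by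
  have hy0 : 0 < ‖y‖ := norm_pos_iff.2 hy
  have h1 := avgConst_pos hn hα0 hα2
  have hlim : Tendsto (fun r : ℝ => ((‖y‖ ^ 2 - r ^ 2) ^ (α / 2) * ‖y‖ ^ n)⁻¹) (𝓝 0)
      (𝓝 ((‖y‖ ^ 2 - 0 ^ 2) ^ (α / 2) * ‖y‖ ^ n)⁻¹) := by
    refine ContinuousAt.tendsto (f := fun r : ℝ =>
      ((‖y‖ ^ 2 - r ^ 2) ^ (α / 2) * ‖y‖ ^ n)⁻¹) (ContinuousAt.inv₀ ?_ ?_)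
    · refine ContinuousAt.mul (ContinuousAt.rpow_const (by fun_prop) (Or.inl ?_))
        continuousAt_const
      simpa using hy0.ne'
    · simp only [ne_eq, OfNat.ofNat_ne_zero, not_false_eq_true, zero_pow, sub_zero]
      positivity
  have he : ((‖y‖ ^ 2 - 0 ^ 2) ^ (α / 2) * ‖y‖ ^ n)⁻¹ = ‖y‖ ^ (-((n : ℝ) + α)) := by
    rw [Real.rpow_neg hy0.le, Real.rpow_add hy0, Real.rpow_natCast, mul_comm (‖y‖ ^ n),
      zero_pow two_ne_zero, sub_zero, ← Real.rpow_natCast ‖y‖ 2, ← Real.rpow_mul hy0.le]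
    congr 3
    push_cast
    ring
  rw [he] at hlim
  refine (hlim.mono_left nhdsWithin_le_nhds).congr' ?_
  filter_upwards [self_mem_nhdsWithin, nhdsWithin_le_nhds (Iio_mem_nhds hy0)] with r hr hr'
  have h2 : 0 < r ^ α := Real.rpow_pos_of_pos hr _
  rw [scaledKernel, avgKernel_of_lt hr']
  field_simp

/-- The part of the scaled second difference integral near the singularity. -/
theorem norm_setIntegral_scaledKernel_near_le (hn : 1 ≤ n) (hα0 : 0 < α) (hα2 : α < 2)
    {A : ℝ} {φ : EuclideanSpace ℝ (Fin n) → ℝ} (h : DecayBound (2 * n + 2) A φ) {r : ℝ}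
    (hr : 0 < r) (hr1 : 2 * r ≤ 1) (z : EuclideanSpace ℝ (Fin n)) :
    ‖∫ y in closedBall 0 (2 * r), scaledKernel n α r y * secondDiff φ z y‖ ≤
      4 * A / avgConst n α * (1 + ‖z‖) ^ (-((n : ℝ) + α)) * r ^ (2 - α) := by
  have hc := avgConst_pos hn hα0 hα2
  have hA := h.nonneg
  have hrα : 0 < r ^ α := Real.rpow_pos_of_pos hr _
  have hK := integrable_scaledKernel hn hα0 hα2 hr
  have hwle : (1 + ‖z‖) ^ (-(2 * (n : ℝ) + 2)) ≤ (1 + ‖z‖) ^ (-((n : ℝ) + α)) := by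
    refine Real.rpow_le_rpow_of_exponent_le (by linarith [norm_nonneg z]) ?_
    have : (0 : ℝ) ≤ n := n.cast_nonneg
    linarith
  have hint : ∫ y, scaledKernel n α r y = (avgConst n α * r ^ α)⁻¹ := by
    unfold scaledKernel
    rw [integral_const_mul, integral_avgKernel hn hα0 hα2 hr, mul_one]
  set D := A * (2 * r) ^ 2 * (1 + ‖z‖) ^ (-((n : ℝ) + α)) with hD
  have hD0 : 0 ≤ D := by positivity
  calc ‖∫ y in closedBall 0 (2 * r), scaledKernel n α r y * secondDiff φ z y‖
      ≤ ∫ y in closedBall 0 (2 * r), scaledKernel n α r y * D := by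
        refine norm_integral_le_of_norm_le (hK.mul_const D).integrableOn ?_
        refine (ae_restrict_iff' measurableSet_closedBall).2 (Eventually.of_forall fun y hy => ?_)
        have hy : ‖y‖ ≤ 2 * r := mem_closedBall_zero_iff.1 hy
        have h0 := scaledKernel_nonneg hn hα0 hα2 hr y
        rw [norm_mul, Real.norm_of_nonneg h0]
        gcongr
        refine (h.diff2 z y (hy.trans hr1)).trans ?_
        rw [hD]
        gcongr
    _ ≤ ∫ y, scaledKernel n α r y * D :=
        setIntegral_le_integral (hK.mul_const D) (Eventually.of_forall fun y =>
          mul_nonneg (scaledKernel_nonneg hn hα0 hα2 hr y) hD0)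
    _ = _ := by
        rw [integral_mul_const, hint, hD, Real.rpow_sub hr, Real.rpow_two]
        field_simp
        ring

theorem norm_scaledKernel_far_le (hn : 1 ≤ n) (hα0 : 0 < α) (hα2 : α < 2)
    {A : ℝ} {φ : EuclideanSpace ℝ (Fin n) → ℝ} (h : DecayBound (2 * n + 2) A φ) {r : ℝ}
    (hr : 0 < r) (z y : EuclideanSpace ℝ (Fin n)) :
    ‖(closedBall 0 (2 * r))ᶜ.indicator (fun y => scaledKernel n α r y * secondDiff φ z y) y‖ ≤
      2 ^ α * A * (1 + ‖z‖) ^ (-((n : ℝ) + α)) * domFun n α z y := by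
  have hA := h.nonneg
  by_cases hy : y ∈ (closedBall (0 : EuclideanSpace ℝ (Fin n)) (2 * r))ᶜ
  · rw [Set.indicator_of_mem hy]
    have hy' : 2 * r < ‖y‖ := by simpa using hy
    rw [norm_mul, Real.norm_of_nonneg (scaledKernel_nonneg hn hα0 hα2 hr y)]
    calc scaledKernel n α r y * ‖secondDiff φ z y‖
        ≤ 2 ^ α * ‖y‖ ^ (-((n : ℝ) + α)) * ‖secondDiff φ z y‖ := by
          gcongr
          exact scaledKernel_le hn hα0 hα2 hr hy'
      _ = 2 ^ α * (‖secondDiff φ z y‖ * ‖y‖ ^ (-((n : ℝ) + α))) := by ring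
      _ ≤ 2 ^ α * (A * (1 + ‖z‖) ^ (-((n : ℝ) + α)) * domFun n α z y) :=
          mul_le_mul_of_nonneg_left (h.norm_secondDiff_mul_le hα0 hα2 z y) (by positivity)
      _ = _ := by ring
  · rw [Set.indicator_of_notMem hy, norm_zero]
    have := domFun_nonneg (α := α) z y
    positivity

theorem integral_scaledKernel_eq_add (hn : 1 ≤ n) (hα0 : 0 < α) (hα2 : α < 2)
    {A : ℝ} {φ : EuclideanSpace ℝ (Fin n) → ℝ} (h : DecayBound (2 * n + 2) A φ) {r : ℝ}
    (hr : 0 < r) (z : EuclideanSpace ℝ (Fin n)) :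
    ∫ y, scaledKernel n α r y * secondDiff φ z y =
      (∫ y in closedBall 0 (2 * r), scaledKernel n α r y * secondDiff φ z y) +
      ∫ y, (closedBall 0 (2 * r))ᶜ.indicator
        (fun y => scaledKernel n α r y * secondDiff φ z y) y := by
  have hsd : ∀ y, ‖secondDiff φ z y‖ ≤ A + A + A + A := by
    intro y
    have hb := fun x => h.norm_le (by positivity) x
    unfold secondDiff
    refine (norm_sub_le _ _).trans (add_le_add ((norm_sub_le _ _).trans (add_le_add
      ((norm_add_le _ _).trans (add_le_add ?_ ?_)) ?_)) ?_) <;> exact hb _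
  have hi : Integrable fun y => scaledKernel n α r y * secondDiff φ z y :=
    (integrable_scaledKernel hn hα0 hα2 hr).mul_bdd
      ((continuous_secondDiff h.cont).comp (Continuous.prodMk_right z)).aestronglyMeasurable
      (Eventually.of_forall hsd)
  rw [integral_indicator measurableSet_closedBall.compl,
    integral_add_compl measurableSet_closedBall hi]

theorem norm_integral_scaledKernel_le (hn : 1 ≤ n) (hα0 : 0 < α) (hα2 : α < 2)
    {A : ℝ} {φ : EuclideanSpace ℝ (Fin n) → ℝ} (h : DecayBound (2 * n + 2) A φ) {r : ℝ}
    (hr : 0 < r) (hr1 : 2 * r ≤ 1) (z : EuclideanSpace ℝ (Fin n)) :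
    ‖∫ y, scaledKernel n α r y * secondDiff φ z y‖ ≤
      (4 * A / avgConst n α + 2 ^ α * A * ∫ y, domFun n α (0 : EuclideanSpace ℝ (Fin n)) y) *
        (1 + ‖z‖) ^ (-((n : ℝ) + α)) := by
  have hc := avgConst_pos hn hα0 hα2
  have hA := h.nonneg
  rw [integral_scaledKernel_eq_add hn hα0 hα2 h hr, add_mul]
  refine norm_add_le_of_le ?_ ?_
  · refine (norm_setIntegral_scaledKernel_near_le hn hα0 hα2 h hr hr1 z).trans ?_
    exact mul_le_of_le_one_right (by positivity)
      (Real.rpow_le_one hr.le (by linarith) (by linarith))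
  · refine (norm_integral_le_of_norm_le ((integrable_domFun hn hα0 hα2 z).const_mul _)
      (Eventually.of_forall (norm_scaledKernel_far_le hn hα0 hα2 h hr z))).trans_eq ?_
    rw [integral_const_mul, integral_domFun hn hα0 hα2]
    ring

theorem tendsto_integral_scaledKernel (hn : 1 ≤ n) (hα0 : 0 < α) (hα2 : α < 2)
    {A : ℝ} {φ : EuclideanSpace ℝ (Fin n) → ℝ} (h : DecayBound (2 * n + 2) A φ)
    (z : EuclideanSpace ℝ (Fin n)) :
    Tendsto (fun r => ∫ y, scaledKernel n α r y * secondDiff φ z y) (𝓝[>] 0)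
      (𝓝 (secondDiffLap n α φ z)) := by
  have hsmall : ∀ᶠ r : ℝ in 𝓝[>] 0, 0 < r ∧ 2 * r ≤ 1 := by
    filter_upwards [self_mem_nhdsWithin,
      nhdsWithin_le_nhds (Iio_mem_nhds (show (0 : ℝ) < 1 / 2 by norm_num))] with r hr hr'
    have hr' : r < 1 / 2 := hr'
    exact ⟨hr, by linarith⟩
  have hnear : Tendsto (fun r => ∫ y in closedBall 0 (2 * r),
      scaledKernel n α r y * secondDiff φ z y) (𝓝[>] 0) (𝓝 0) := by
    refine squeeze_zero_norm' (a := fun r =>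
      4 * A / avgConst n α * (1 + ‖z‖) ^ (-((n : ℝ) + α)) * r ^ (2 - α)) ?_ ?_
    · filter_upwards [hsmall] with r hr
      exact norm_setIntegral_scaledKernel_near_le hn hα0 hα2 h hr.1 hr.2 z
    · have h0 : Tendsto (fun r : ℝ => r ^ (2 - α)) (𝓝[>] 0) (𝓝 (0 ^ (2 - α))) :=
        ((Real.continuousAt_rpow_const 0 _ (Or.inr (by linarith))).tendsto).mono_left
          nhdsWithin_le_nhds
      rw [Real.zero_rpow (by linarith)] at h0
      simpa using h0.const_mul (4 * A / avgConst n α * (1 + ‖z‖) ^ (-((n : ℝ) + α)))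
  have hfar : Tendsto (fun r => ∫ y, (closedBall 0 (2 * r))ᶜ.indicator
      (fun y => scaledKernel n α r y * secondDiff φ z y) y) (𝓝[>] 0)
      (𝓝 (secondDiffLap n α φ z)) := by
    refine tendsto_integral_filter_of_dominated_convergence _ (Eventually.of_forall fun r => ?_)
      ?_ ((integrable_domFun hn hα0 hα2 z).const_mul
        (2 ^ α * A * (1 + ‖z‖) ^ (-((n : ℝ) + α)))) (Eventually.of_forall fun y => ?_)
    · refine AEStronglyMeasurable.indicator (AEStronglyMeasurable.mul ?_ ?_)
        measurableSet_closedBall.compl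
      · exact ((measurable_avgKernel r).const_mul _).aestronglyMeasurable
      · exact ((continuous_secondDiff h.cont).comp (Continuous.prodMk_right z)).aestronglyMeasurable
    · filter_upwards [hsmall] with r hr
      exact Eventually.of_forall (norm_scaledKernel_far_le hn hα0 hα2 h hr.1 z)
    · rcases eq_or_ne y 0 with rfl | hy
      · have h0 : secondDiff φ z 0 = 0 := by simp [secondDiff]
        refine tendsto_const_nhds.congr fun r => ?_
        rw [h0, smul_zero]
        refine (Set.indicator_apply_eq_zero.2 fun _ => ?_).symm
        rw [h0, mul_zero]
      · have hy0 : 0 < ‖y‖ := norm_pos_iff.2 hy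
        refine ((tendsto_scaledKernel hn hα0 hα2 hy).mul_const (secondDiff φ z y)).congr' ?_
        filter_upwards [nhdsWithin_le_nhds (Iio_mem_nhds (half_pos hy0))] with r hr
        have hr : r < ‖y‖ / 2 := hr
        rw [Set.indicator_of_mem]
        simp only [Set.mem_compl_iff, mem_closedBall_zero_iff, not_le]
        linarith
  rw [← zero_add (secondDiffLap n α φ z)]
  refine (hnear.add hfar).congr' ?_
  filter_upwards [self_mem_nhdsWithin] with r hr
  exact (integral_scaledKernel_eq_add hn hα0 hα2 h hr z).symm

theorem integral_mul_secondDiffLap_eq_zero (hn : 1 ≤ n) (hα0 : 0 < α) (hα2 : α < 2)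
    {u φ : EuclideanSpace ℝ (Fin n) → ℝ} (hu : InLalpha n α u) (huc : Continuous u)
    (hmv : ∀ x r, 0 < r → avgConv n α r u x = u x) {A : ℝ}
    (h : DecayBound (2 * n + 2) A φ) (hc : HasCompactSupport φ) :
    ∫ z, u z * secondDiffLap n α φ z = 0 := by
  have hzero : ∀ r > 0, ∫ z, u z * ∫ y, scaledKernel n α r y * secondDiff φ z y = 0 := by
    intro r hr
    have h0 := integral_mul_avgKernel_secondDiff hn hα0 hα2 hu huc h.cont hc hr
      fun x => hmv x r hr
    simp only [scaledKernel, mul_assoc, integral_const_mul, mul_left_comm (u _), h0, mul_zero]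
  set B := 4 * A / avgConst n α +
    2 ^ α * A * ∫ y, domFun n α (0 : EuclideanSpace ℝ (Fin n)) y
  have hlim : Tendsto (fun r => ∫ z, u z * ∫ y, scaledKernel n α r y * secondDiff φ z y)
      (𝓝[>] 0) (𝓝 (∫ z, u z * secondDiffLap n α φ z)) := by
    refine tendsto_integral_filter_of_dominated_convergence _ (Eventually.of_forall fun r => ?_)
      ?_ ((hu.integrable_mul_japanese hα0).const_mul B) (Eventually.of_forall fun z => ?_)
    · refine huc.aestronglyMeasurable.mul (StronglyMeasurable.aestronglyMeasurable ?_)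
      have hm : StronglyMeasurable
          fun p : EuclideanSpace ℝ (Fin n) × EuclideanSpace ℝ (Fin n) =>
            scaledKernel n α r p.2 * secondDiff φ p.1 p.2 :=
        StronglyMeasurable.mul
          (((measurable_avgKernel r).const_mul _).comp measurable_snd).stronglyMeasurable
          (continuous_secondDiff h.cont).stronglyMeasurable
      exact hm.integral_prod_right (ν := volume)
    · filter_upwards [self_mem_nhdsWithin,
        nhdsWithin_le_nhds (Iio_mem_nhds (show (0 : ℝ) < 1 / 2 by norm_num))] with r hr hr'
      have hr' : r < 1 / 2 := hr'
      refine Eventually.of_forall fun z => ?_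
      rw [norm_mul, mul_left_comm]
      gcongr
      exact norm_integral_scaledKernel_le hn hα0 hα2 h hr (by linarith) z
    · exact (tendsto_integral_scaledKernel hn hα0 hα2 h z).const_mul _
  refine tendsto_nhds_unique hlim (tendsto_const_nhds.congr' ?_)
  filter_upwards [self_mem_nhdsWithin] with r hr
  exact (hzero r hr).symm

theorem alphaHarmonic_of_avgConv (hn : 1 ≤ n) (hα0 : 0 < α) (hα2 : α < 2)
    {u : EuclideanSpace ℝ (Fin n) → ℝ} (hu : InLalpha n α u) (huc : Continuous u)
    (hmv : ∀ x r, 0 < r → avgConv n α r u x = u x) : AlphaHarmonic n α u := by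
  intro φ hφ hc g hg
  obtain ⟨A, hA⟩ := (hc.toSchwartzMap hφ).exists_decayBound
  change DecayBound (2 * n + 2) A φ at hA
  have e : ∀ x, g x = secondDiffLap n α φ x / 2 := fun x =>
    tendsto_nhds_unique (hg x) (hA.isFracLapAt hn hα0 hα2 x)
  simp only [e, ← mul_div_assoc]
  rw [integral_div, integral_mul_secondDiffLap_eq_zero hn hα0 hα2 hu huc hmv hA hc, zero_div]

end MeanValue

/-- A distributionally `α`-harmonic `u ∈ L_α` coincides a.e. with a smooth function which
is `α`-harmonic in the average sense at every point; conversely, a continuous `u ∈ L_α`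
which is `α`-harmonic in the average sense at every point is distributionally
`α`-harmonic. -/
theorem alphaHarmonic_iff_avg_harmonic (n : ℕ) (hn : 1 ≤ n) (α : ℝ)
    (hα0 : 0 < α) (hα2 : α < 2) :
    (∀ u : EuclideanSpace ℝ (Fin n) → ℝ, InLalpha n α u → AlphaHarmonic n α u →
      ∃ v : EuclideanSpace ℝ (Fin n) → ℝ, ContDiff ℝ (⊤ : ℕ∞) v ∧
        (∀ᵐ x : EuclideanSpace ℝ (Fin n), u x = v x) ∧
        ∀ (x : EuclideanSpace ℝ (Fin n)) (r : ℝ), 0 < r → avgConv n α r v x = v x) ∧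
    (∀ u : EuclideanSpace ℝ (Fin n) → ℝ, InLalpha n α u → Continuous u →
      (∀ (x : EuclideanSpace ℝ (Fin n)) (r : ℝ), 0 < r → avgConv n α r u x = u x) →
      AlphaHarmonic n α u) := by
  refine ⟨fun u hu h => ?_, fun u hu huc hmv => alphaHarmonic_of_avgConv hn hα0 hα2 hu huc hmv⟩
  obtain ⟨L, c, hLc⟩ := h.ae_eq_affine hn hα0 hα2 hu
  have hv : InLalpha n α fun x => L x + c := by
    refine Integrable.congr hu ?_
    filter_upwards [hLc] with x hx
    rw [hx]
  exact ⟨fun x => L x + c, L.contDiff.add contDiff_const, hLc,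
    fun x r hr => avgConv_affine hn hα0 hα2 L c hv x hr⟩
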